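/- arXiv:2602.03289 — 2 statements merged into one kernel-verified Lean document; each statement's English description precedes it below -/
import Mathlib

section
/- Let f ∈ F(x) and let c₁,…,cₙ ∈ F be nonzero; write θ̃_{x_i} = c_i·θ_{x_i}. Then f is (θ̃_{x₁},…,θ̃_{xₙ})-summable in F(x) if and only if the polynomial part f₀ is (θ̃_{x₁},…,θ̃_{xₙ})-summable with witnesses g₁,…,gₙ ∈ F(x̂₁)[x₁], and every component f_{[d]_G,j} is (θ̃_{x₁},…,θ̃_{xₙ})-summable in F(x). -/
noncomputable section

/-- The field of rational functions `F(x₁,…,xₙ)`, modeled as the fraction field of the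
multivariate polynomial ring. -/
abbrev MvRat (F : Type*) [Field F] (n : ℕ) := FractionRing (MvPolynomial (Fin n) F)

/-- The image of the variable `xᵢ` in `F(x₁,…,xₙ)`. -/
def xv {F : Type*} [Field F] {n : ℕ} (i : Fin n) : MvRat F n :=
  algebraMap (MvPolynomial (Fin n) F) (MvRat F n) (MvPolynomial.X i)

/-- The subfield `F(x₂,…,xₙ)` of `F(x₁,…,xₙ)` (the variable `x₁` has index `0`). -/
def hatField (F : Type*) [Field F] (n : ℕ) [NeZero n] : Subfield (MvRat F n) :=
  Subfield.closure (Set.range (algebraMap F (MvRat F n)) ∪ (xv '' {i : Fin n | i ≠ 0}))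

/-- `a` is a polynomial in `x1` over the subfield `E` of degree `< D`. -/
def IsPolyDeg {L : Type*} [Field L] (E : Subfield L) (x1 : L) (D : ℕ) (a : L) : Prop :=
  ∃ cf : Fin D → E, a = ∑ k : Fin D, (cf k : L) * x1 ^ (k : ℕ)

/-- `a` is a polynomial in `x1` over the subfield `E`, i.e. `a ∈ E[x1]`. -/
def IsPolyE {L : Type*} [Field L] (E : Subfield L) (x1 a : L) : Prop :=
  ∃ D : ℕ, IsPolyDeg E x1 D a

/-- `a` is a Laurent polynomial in `x1` over the subfield `E`, i.e. `a ∈ E[x1, x1⁻¹]`. -/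
def IsLaurent {L : Type*} [Field L] (E : Subfield L) (x1 a : L) : Prop :=
  ∃ (s : Finset ℤ) (cf : ℤ → L), (∀ k ∈ s, cf k ∈ E) ∧ a = ∑ k ∈ s, cf k * x1 ^ k

/-- For a family `θ` of `F`-automorphisms and an exponent vector `α`,
the product `∏ i, θᵢ^(αᵢ)` (the element `θ_x^α` of the group generated by the `θᵢ`). -/
def thetaPowS {F L : Type*} [CommSemiring F] [Semiring L] [Algebra F L] {ι : Type*} [Fintype ι]
    (θ : ι → (L ≃ₐ[F] L)) (α : ι → ℤ) : L ≃ₐ[F] L :=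
  (Finset.univ.toList.map fun i => θ i ^ α i).prod

/-- Membership in the space `V_{[d]_G,j}`: `f` is a finite sum of fractions `a_g / g(d)^j`
with `g` in the group `G` and `a_g ∈ E[x₁]` of degree `< D` (`= deg_{x₁} d`). -/
def MemV {F L : Type*} [Field F] [Field L] [Algebra F L] (G : Set (L ≃ₐ[F] L))
    (E : Subfield L) (x1 : L) (dd : L) (D j : ℕ) (f : L) : Prop :=
  ∃ s : Finset (L ≃ₐ[F] L), ↑s ⊆ G ∧ ∃ a : (L ≃ₐ[F] L) → L,
    (∀ g ∈ s, IsPolyDeg E x1 D (a g)) ∧ f = ∑ g ∈ s, a g / (g dd) ^ j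

/-- `p` and `p'` are `G`-equivalent: `p = c · g(p')` for some nonzero `c ∈ F` and `g ∈ G`. -/
def GEquivSet {F L : Type*} [Field F] [Field L] [Algebra F L] (G : Set (L ≃ₐ[F] L))
    (p p' : L) : Prop :=
  ∃ c : F, c ≠ 0 ∧ ∃ g ∈ G, p = algebraMap F L c * g p'

/-- `w` divides `p` inside the ring `E[x1]`. -/
def DvdE {L : Type*} [Field L] (E : Subfield L) (x1 w p : L) : Prop :=
  ∃ u : L, IsPolyE E x1 u ∧ p = w * u

/-- `p ∈ E[x₁]` is normal w.r.t. `θ1`: `gcd(p, θ1^ℓ(p)) = 1` for all nonzero `ℓ ∈ ℤ`,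
i.e. every common divisor (in `E[x₁]`) of `p` and `θ1^ℓ(p)` is a unit (lies in `E`). -/
def NormalWrt {F L : Type*} [Field F] [Field L] [Algebra F L] (E : Subfield L) (x1 : L)
    (θ1 : L ≃ₐ[F] L) (p : L) : Prop :=
  ∀ ℓ : ℤ, ℓ ≠ 0 → ∀ w : L, IsPolyE E x1 w →
    DvdE E x1 w p → DvdE E x1 w ((θ1 ^ ℓ) p) → w ∈ E

/-- The isotropy group of `p` (in exponent-vector coordinates): the subgroup of `ℤ^ι`
of all `α` with `Θ(α)(p) = c·p` for some nonzero `c ∈ F`. -/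
def isotropyZ {F L : Type*} [Field F] [Field L] [Algebra F L] {ι : Type*}
    (Θ : (ι → ℤ) → (L ≃ₐ[F] L))
    (hadd : ∀ α β, Θ (α + β) = Θ α * Θ β) (h0 : Θ 0 = 1) (p : L) :
    AddSubgroup (ι → ℤ) where
  carrier := {α | ∃ c : F, c ≠ 0 ∧ Θ α p = algebraMap F L c * p}
  zero_mem' := ⟨1, one_ne_zero, by simp [h0]⟩
  add_mem' := by
    rintro α β ⟨c, hc, hcp⟩ ⟨e, he, hep⟩
    refine ⟨e * c, mul_ne_zero he hc, ?_⟩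
    rw [hadd, AlgEquiv.mul_apply, hep, map_mul, AlgEquiv.commutes, hcp, map_mul]
    ring
  neg_mem' := by
    rintro α ⟨c, hc, hcp⟩
    refine ⟨c⁻¹, inv_ne_zero hc, ?_⟩
    have h1 : Θ (-α) (Θ α p) = p := by
      rw [← AlgEquiv.mul_apply, ← hadd, neg_add_cancel, h0, AlgEquiv.one_apply]
    rw [hcp, map_mul, AlgEquiv.commutes] at h1
    have hc0 : (algebraMap F L) c ≠ 0 :=
      (map_ne_zero_iff _ (algebraMap F L).injective).mpr hc
    rw [map_inv₀, eq_inv_mul_iff_mul_eq₀ hc0]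
    exact h1

end



section PartialFractions

open Polynomial

variable {K L : Type*} [Field K] [Field L]

/-- The pieces of the partial fraction decomposition of a field `L` of fractions of `K[X]`
(embedded through `emb`): the polynomials, and for each monic irreducible `p` and each `j`
the fractions `a / p ^ (j + 1)` with `deg a < deg p`. -/
noncomputable def fracPiece (emb : K[X] →+* L) :
    Option ({p : K[X] // p.Monic ∧ Irreducible p} × ℕ) → Submodule ℤ L
  | none => LinearMap.range emb.toAddMonoidHom.toIntLinearMap
  | some (p, j) =>
    { carrier := {z | ∃ a : K[X], a.degree < p.1.degree ∧ z = emb a / emb p.1 ^ (j + 1)}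
      zero_mem' := ⟨0, by
        rw [degree_zero, bot_lt_iff_ne_bot, degree_ne_bot]; exact p.2.1.ne_zero, by simp⟩
      add_mem' := by
        rintro _ _ ⟨a, ha, rfl⟩ ⟨b, hb, rfl⟩
        exact ⟨a + b, (degree_add_le a b).trans_lt (max_lt ha hb), by rw [map_add, add_div]⟩
      smul_mem' := by
        rintro k _ ⟨a, ha, rfl⟩
        refine ⟨k • a, ?_, by rw [map_zsmul, smul_div_assoc]⟩
        rw [← Int.cast_smul_eq_zsmul K]
        exact (degree_smul_le _ _).trans_lt ha }

lemma mem_fracPiece_none {emb : K[X] →+* L} {z : L} :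
    z ∈ fracPiece emb none ↔ ∃ a, emb a = z := Iff.rfl

lemma mem_fracPiece_some {emb : K[X] →+* L} {p : {p : K[X] // p.Monic ∧ Irreducible p}} {j : ℕ}
    {z : L} : z ∈ fracPiece emb (some (p, j)) ↔
      ∃ a : K[X], a.degree < p.1.degree ∧ z = emb a / emb p.1 ^ (j + 1) := Iff.rfl

lemma isCoprime_of_monic_irreducible {p q : K[X]} (hp : p.Monic) (hp' : Irreducible p)
    (hq : q.Monic) (hq' : Irreducible q) (h : p ≠ q) : IsCoprime p q := by
  refine (hp'.coprime_iff_not_dvd).2 fun hdvd => h ?_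
  exact eq_of_monic_of_associated hp hq (hp'.associated_of_dvd hq' hdvd)

theorem iSupIndep_fracPiece {emb : K[X] →+* L} (hemb : Function.Injective emb) :
    iSupIndep (fracPiece emb) := by
  classical
  let _ : Algebra K[X] L := emb.toAlgebra
  have _ : FaithfulSMul K[X] L := (faithfulSMul_iff_algebraMap_injective _ _).2 hemb
  rw [iSupIndep_iff_finsetSum_eq_zero_imp_eq_zero]
  intro s v hv hsum
  have hv' : ∀ i, (if i ∈ s then v i else 0) ∈ fracPiece emb i := fun i => by
    split_ifs with h
    exacts [hv i h, zero_mem _]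
  obtain ⟨q, hq⟩ := mem_fracPiece_none.1 (hv' none)
  choose r hr hrv using fun p j => mem_fracPiece_some.1 (hv' (some (p, j)))
  set t := s.eraseNone.image Prod.fst
  set N := (s.eraseNone.image Prod.snd).sup id + 1
  have hsub : s ⊆ Finset.insertNone (t ×ˢ Finset.range N) := by
    intro i hi
    cases i with
    | none => simp
    | some i =>
      have hi' : i ∈ s.eraseNone := by simpa using hi
      simp only [Finset.some_mem_insertNone, Finset.mem_product, Finset.mem_range]
      exact ⟨Finset.mem_image_of_mem _ hi', Nat.lt_succ_of_le
        (Finset.le_sup (f := id) (Finset.mem_image_of_mem Prod.snd hi'))⟩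
  have hsum' : emb q + ∑ p ∈ t, ∑ j : Fin N, emb (r p j) * (emb p.1)⁻¹ ^ (j.1 + 1) = 0 := by
    rw [← hsum, ← Finset.sum_congr (s₁ := s) (f := fun i => if i ∈ s then v i else 0) rfl
        (fun i hi => if_pos hi),
      Finset.sum_subset hsub (fun i _ hi => if_neg hi), Finset.sum_insertNone, hq,
      Finset.sum_product]
    congr 1
    refine Finset.sum_congr rfl fun p _ => ?_
    rw [Finset.sum_range]
    refine Finset.sum_congr rfl fun j _ => ?_
    rw [hrv, inv_pow, div_eq_mul_inv]
  have hbot : ∀ p : {p : K[X] // p.Monic ∧ Irreducible p}, (0 : K[X]).degree < p.1.degree :=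
    fun p => by rw [degree_zero, bot_lt_iff_ne_bot, degree_ne_bot]; exact p.2.1.ne_zero
  obtain ⟨hq0, hr0⟩ := quo_add_sum_rem_mul_pow_inverse_unique (K := L) (s := t)
    (g := fun p => p.1) (n := fun _ => N) (gi := fun p => (emb p.1)⁻¹) (q₁ := q) (q₂ := 0)
    (r₁ := fun p j => r p j) (r₂ := fun _ _ => 0) (fun p _ => p.2.1)
    (fun p _ p' _ hne => isCoprime_of_monic_irreducible p.2.1 p.2.2 p'.2.1 p'.2.2
      (fun h => hne (Subtype.ext h)))
    (fun p _ => inv_mul_cancel₀ ((map_ne_zero_iff emb hemb).2 p.2.1.ne_zero))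
    (fun p _ j => hr p j) (fun p _ _ => hbot p)
    (by simpa [RingHom.algebraMap_toAlgebra] using hsum')
  intro i hi
  rw [← if_pos (c := i ∈ s) (t := v i) (e := 0) hi]
  cases i with
  | none => rw [← hq, hq0, map_zero]
  | some i =>
    obtain ⟨p, j⟩ := i
    have hm := hsub hi
    simp only [Finset.some_mem_insertNone, Finset.mem_product, Finset.mem_range] at hm
    have := congrFun (hr0 p hm.1) ⟨j, hm.2⟩
    simp only at this
    rw [hrv, this, map_zero, zero_div]

theorem iSup_fracPiece {emb : K[X] →+* L} (hemb : Function.Injective emb)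
    (hfrac : ∀ z : L, ∃ a b : K[X], b ≠ 0 ∧ z = emb a / emb b) :
    ⨆ i, fracPiece emb i = ⊤ := by
  classical
  let _ : Algebra K[X] L := emb.toAlgebra
  rw [eq_top_iff]
  rintro z -
  obtain ⟨a, b, hb, rfl⟩ := hfrac z
  have hmem : ∀ p ∈ (UniqueFactorizationMonoid.normalizedFactors b).toFinset,
      p.Monic ∧ Irreducible p := fun p hp => by
    rw [Multiset.mem_toFinset] at hp
    have hirr := UniqueFactorizationMonoid.irreducible_of_normalized_factor p hp
    exact ⟨(normalize_eq_self_iff_monic hirr.ne_zero).1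
      (UniqueFactorizationMonoid.normalize_normalized_factor p hp), hirr⟩
  obtain ⟨u, hu⟩ := UniqueFactorizationMonoid.prod_normalizedFactors hb
  set m := UniqueFactorizationMonoid.normalizedFactors b
  obtain ⟨q, r, hr, h⟩ := mul_prod_pow_inverse_eq_quo_add_sum_rem_mul_pow_inverse (K := L)
    (s := m.toFinset) (g := id) (a * (u⁻¹ : (K[X])ˣ).1) (fun p hp => (hmem p hp).1)
    (fun p hp p' hp' hne => isCoprime_of_monic_irreducible (hmem p hp).1 (hmem p hp).2
      (hmem p' hp').1 (hmem p' hp').2 hne) (fun p => m.count p)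
    (gi := fun p => (emb p)⁻¹)
    (fun p hp => inv_mul_cancel₀ ((map_ne_zero_iff emb hemb).2 (hmem p hp).1.ne_zero))
  simp only [RingHom.algebraMap_toAlgebra] at h
  have hz : emb a / emb b =
      emb (a * (u⁻¹ : (K[X])ˣ).1) * ∏ p ∈ m.toFinset, (emb p)⁻¹ ^ m.count p := by
    have hprod : ∏ p ∈ m.toFinset, (emb p)⁻¹ ^ m.count p = (emb m.prod)⁻¹ := by
      rw [Finset.prod_multiset_count, map_prod, ← Finset.prod_inv_distrib]
      simp
    have hu0 : emb (u⁻¹ : (K[X])ˣ).1 * emb u.1 = 1 := by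
      rw [← map_mul, Units.inv_mul, map_one]
    have hm0 : emb m.prod ≠ 0 := (map_ne_zero_iff emb hemb).2 fun h0 => hb (by simp [← hu, h0])
    rw [hprod, ← hu, map_mul, map_mul, eq_comm, eq_div_iff (mul_ne_zero hm0
      ((map_ne_zero_iff emb hemb).2 u.ne_zero))]
    field_simp
    linear_combination emb a * hu0
  rw [hz, h]
  refine add_mem (Submodule.mem_iSup_of_mem none ⟨q, rfl⟩)
    (sum_mem fun p hp => sum_mem fun j _ => ?_)
  exact Submodule.mem_iSup_of_mem (some (⟨p, hmem p hp⟩, j.1))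
    ⟨r p j, hr p hp j, by rw [div_eq_mul_inv, inv_pow]⟩

theorem isCompl_biSup_fracPiece {emb : K[X] →+* L} (hemb : Function.Injective emb)
    (hfrac : ∀ z : L, ∃ a b : K[X], b ≠ 0 ∧ z = emb a / emb b)
    (S : Set (Option ({p : K[X] // p.Monic ∧ Irreducible p} × ℕ))) :
    IsCompl (⨆ i ∈ S, fracPiece emb i) (⨆ i ∈ Sᶜ, fracPiece emb i) := by
  refine ⟨(iSupIndep_fracPiece hemb).disjoint_biSup_biSup disjoint_compl_right, ?_⟩
  rw [codisjoint_iff, ← iSup_union, Set.union_compl_self, iSup_univ, iSup_fracPiece hemb hfrac]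

/-- If an additive group is the direct sum of two parts stable under the operators `T i`, a
telescoping representation of `u + v` restricts to one of the component `u`. -/
lemma exists_sum_sub_of_isCompl {ι M : Type*} [Fintype ι] [AddCommGroup M]
    {U V : Submodule ℤ M} (hUV : IsCompl U V) (T : ι → M →+ M)
    (hU : ∀ i, ∀ z ∈ U, T i z ∈ U) (hV : ∀ i, ∀ z ∈ V, T i z ∈ V)
    {u v : M} (hu : u ∈ U) (hv : v ∈ V) (g : ι → M) (h : u + v = ∑ i, (T i (g i) - g i)) :
    ∃ g' : ι → M, (∀ i, g' i ∈ U) ∧ u = ∑ i, (T i (g' i) - g' i) := by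
  have hg : ∀ i, ∃ a ∈ U, ∃ b ∈ V, a + b = g i := fun i =>
    Submodule.mem_sup.1 (hUV.sup_eq_top ▸ Submodule.mem_top)
  choose a ha b hb hab using hg
  refine ⟨a, ha, sub_eq_zero.1 (Submodule.disjoint_def.1 hUV.disjoint _ ?_ ?_)⟩
  · exact sub_mem hu (sum_mem fun i _ => sub_mem (hU i _ (ha i)) (ha i))
  · have : u - ∑ i, (T i (a i) - a i) = ∑ i, (T i (b i) - b i) - v := by
      rw [sub_eq_sub_iff_add_eq_add, h, ← Finset.sum_add_distrib]
      refine Finset.sum_congr rfl fun i _ => ?_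
      rw [← hab, map_add]
      abel
    rw [this]
    exact sub_mem (sum_mem fun i _ => sub_mem (hV i _ (hb i)) (hb i)) hv

end PartialFractions

section RationalFunctions

open Polynomial

variable {F : Type*} [Field F] {m : ℕ}

lemma xv_mem_hatField {n : ℕ} [NeZero n] {i : Fin n} (hi : i ≠ 0) : xv i ∈ hatField F n :=
  Subfield.subset_closure (Or.inr ⟨i, hi, rfl⟩)

lemma algebraMap_mem_hatField {n : ℕ} [NeZero n] (a : F) :
    algebraMap F (MvRat F n) a ∈ hatField F n :=
  Subfield.subset_closure (Or.inl ⟨a, rfl⟩)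

/-- The inclusion of the polynomials in `x₂,…,xₙ` into `F(x₂,…,xₙ)`. -/
noncomputable def hatHom : MvPolynomial (Fin m) F →+* hatField F (m + 1) :=
  ((algebraMap (MvPolynomial (Fin (m + 1)) F) (MvRat F (m + 1))).comp
    (MvPolynomial.rename (R := F) Fin.succ).toRingHom).codRestrict (hatField F (m + 1)) fun p => by
      induction p using MvPolynomial.induction_on with
      | C a =>
        simp only [AlgHom.toRingHom_eq_coe, RingHom.coe_comp, RingHom.coe_coe,
          Function.comp_apply, MvPolynomial.rename_C]
        exact algebraMap_mem_hatField a
      | add p q hp hq => rw [map_add]; exact add_mem hp hq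
      | mul_X p i hp =>
        rw [map_mul]
        refine mul_mem hp ?_
        simp only [AlgHom.toRingHom_eq_coe, RingHom.coe_comp, RingHom.coe_coe,
          Function.comp_apply, MvPolynomial.rename_X]
        exact xv_mem_hatField (Fin.succ_ne_zero i)

lemma coe_hatHom (p : MvPolynomial (Fin m) F) :
    (hatHom p : MvRat F (m + 1)) = algebraMap _ (MvRat F (m + 1)) (p.rename Fin.succ) := rfl

lemma hatHom_injective : Function.Injective (hatHom (F := F) (m := m)) := fun p q h => by
  have h' := congrArg Subtype.val h
  rw [coe_hatHom, coe_hatHom] at h'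
  exact MvPolynomial.rename_injective _ (Fin.succ_injective m)
    (IsFractionRing.injective _ (MvRat F (m + 1)) h')

lemma isFractionRing_hatField :
    letI := (hatHom (F := F) (m := m)).toAlgebra
    IsFractionRing (MvPolynomial (Fin m) F) (hatField F (m + 1)) := by
  let _ : Algebra (MvPolynomial (Fin m) F) (hatField F (m + 1)) :=
    (hatHom (F := F) (m := m)).toAlgebra
  have _ : FaithfulSMul (MvPolynomial (Fin m) F) (hatField F (m + 1)) :=
    (faithfulSMul_iff_algebraMap_injective _ _).2 hatHom_injective
  have hle : Subring.closure (Set.range (algebraMap F (MvRat F (m + 1))) ∪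
      (xv '' {i : Fin (m + 1) | i ≠ 0})) ≤ ((hatField F (m + 1)).subtype.comp hatHom).range := by
    rw [Subring.closure_le]
    rintro _ (⟨a, rfl⟩ | ⟨i, hi, rfl⟩)
    · refine ⟨MvPolynomial.C a, ?_⟩
      simp only [RingHom.comp_apply, Subfield.subtype_apply, coe_hatHom, MvPolynomial.rename_C]
      rfl
    · obtain ⟨k, rfl⟩ := Fin.exists_succ_eq_of_ne_zero hi
      refine ⟨MvPolynomial.X k, ?_⟩
      simp only [RingHom.comp_apply, Subfield.subtype_apply, coe_hatHom, MvPolynomial.rename_X]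
      rfl
  refine IsFractionRing.of_field _ _ fun z => ?_
  obtain ⟨y, hy, w, hw, h⟩ := Subfield.mem_closure_iff.1 z.2
  obtain ⟨a, rfl⟩ := hle hy
  obtain ⟨b, rfl⟩ := hle hw
  exact ⟨a, b, Subtype.ext h.symm⟩

/-- The embedding of `F(x₂,…,xₙ)[X]` into `F(x₁,…,xₙ)` sending `X` to `x₁`. -/
noncomputable def hatEmb (F : Type*) [Field F] (n : ℕ) [NeZero n] :
    (hatField F n)[X] →+* MvRat F n :=
  eval₂RingHom (hatField F n).subtype (xv 0)

/-- A polynomial in `x₁,…,xₙ` viewed as a polynomial in `x₁` over `F(x₂,…,xₙ)`. -/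
noncomputable def toHatPoly : MvPolynomial (Fin (m + 1)) F →+* (hatField F (m + 1))[X] :=
  (mapRingHom hatHom).comp (MvPolynomial.finSuccEquiv F m).toRingEquiv.toRingHom

lemma toHatPoly_apply (p : MvPolynomial (Fin (m + 1)) F) :
    toHatPoly p = (MvPolynomial.finSuccEquiv F m p).map hatHom := rfl

@[simp]
lemma hatEmb_C {n : ℕ} [NeZero n] (a : hatField F n) : hatEmb F n (C a) = a := by
  simp [hatEmb]

@[simp]
lemma hatEmb_X {n : ℕ} [NeZero n] : hatEmb F n X = xv 0 := by
  simp [hatEmb]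

lemma hatEmb_toHatPoly (p : MvPolynomial (Fin (m + 1)) F) :
    hatEmb F (m + 1) (toHatPoly p) = algebraMap _ (MvRat F (m + 1)) p := by
  rw [← RingHom.comp_apply]
  congr 1
  refine MvPolynomial.ringHom_ext (fun a => ?_) fun i => ?_
  · rw [RingHom.comp_apply, toHatPoly_apply, MvPolynomial.finSuccEquiv_apply]
    simp [coe_hatHom]
  · rw [RingHom.comp_apply, toHatPoly_apply]
    refine Fin.cases ?_ (fun k => ?_) i
    · rw [MvPolynomial.finSuccEquiv_X_zero, map_X, hatEmb_X]
      rfl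
    · rw [MvPolynomial.finSuccEquiv_X_succ, map_C, hatEmb_C, coe_hatHom, MvPolynomial.rename_X]

lemma toHatPoly_natDegree (p : MvPolynomial (Fin (m + 1)) F) :
    (toHatPoly p).natDegree = p.degreeOf 0 := by
  rw [toHatPoly_apply, natDegree_map_eq_of_injective hatHom_injective,
    MvPolynomial.natDegree_finSuccEquiv]

lemma hatEmb_injective : Function.Injective (hatEmb F (m + 1)) := by
  rw [injective_iff_map_eq_zero]
  intro p hp
  let _ := (hatHom (F := F) (m := m)).toAlgebra
  have := isFractionRing_hatField (F := F) (m := m)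
  obtain ⟨b, hbM, hb⟩ := IsLocalization.integerNormalization_spec
    (nonZeroDivisors (MvPolynomial (Fin m) F)) p
  set p' := IsLocalization.integerNormalization (nonZeroDivisors (MvPolynomial (Fin m) F)) p
  have hb0 : hatHom b ≠ 0 :=
    (map_ne_zero_iff (hatHom (F := F) (m := m)) hatHom_injective).2 (nonZeroDivisors.ne_zero hbM)
  have hmap : p'.map hatHom = C (hatHom b) * p := by
    rw [← smul_eq_C_mul]
    exact hb.trans (algebraMap_smul (hatField F (m + 1)) b p).symm
  have hz : p'.map hatHom = toHatPoly ((MvPolynomial.finSuccEquiv F m).symm p') := by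
    rw [toHatPoly_apply, AlgEquiv.apply_symm_apply]
  have h0 : (MvPolynomial.finSuccEquiv F m).symm p' = 0 := by
    refine (map_eq_zero_iff _ (IsFractionRing.injective _ (MvRat F (m + 1)))).1 ?_
    rw [← hatEmb_toHatPoly, ← hz, hmap, map_mul, hp, mul_zero]
  rw [hz, h0, map_zero, eq_comm, mul_eq_zero, C_eq_zero] at hmap
  exact hmap.resolve_left hb0

lemma exists_hatEmb_div (z : MvRat F (m + 1)) :
    ∃ a b : (hatField F (m + 1))[X], b ≠ 0 ∧ z = hatEmb F (m + 1) a / hatEmb F (m + 1) b := by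
  obtain ⟨a, b, hb, rfl⟩ := IsFractionRing.div_surjective (A := MvPolynomial (Fin (m + 1)) F) z
  refine ⟨toHatPoly a, toHatPoly b, fun h => ?_, by rw [hatEmb_toHatPoly, hatEmb_toHatPoly]⟩
  have := hatEmb_toHatPoly b
  rw [h, map_zero, eq_comm, map_eq_zero_iff _ (IsFractionRing.injective _ _)] at this
  exact nonZeroDivisors.ne_zero hb this

lemma isPrimitive_finSuccEquiv {d : MvPolynomial (Fin (m + 1)) F} (hd : Irreducible d)
    (hdeg : 0 < d.degreeOf 0) : (MvPolynomial.finSuccEquiv F m d).IsPrimitive :=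
  ((MulEquiv.irreducible_iff (MvPolynomial.finSuccEquiv F m)).2 hd).isPrimitive
    (by rw [MvPolynomial.natDegree_finSuccEquiv]; exact hdeg.ne')

lemma irreducible_toHatPoly {d : MvPolynomial (Fin (m + 1)) F} (hd : Irreducible d)
    (hdeg : 0 < d.degreeOf 0) : Irreducible (toHatPoly d) := by
  let _ := (hatHom (F := F) (m := m)).toAlgebra
  have := isFractionRing_hatField (F := F) (m := m)
  exact ((isPrimitive_finSuccEquiv hd hdeg).irreducible_iff_irreducible_map_fraction_map
    (K := hatField F (m + 1))).1 ((MulEquiv.irreducible_iff (MvPolynomial.finSuccEquiv F m)).2 hd)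

/-- Irreducible polynomials, one of positive degree in `x₁`, that are proportional over
`F(x₂,…,xₙ)` are proportional over `F`. -/
lemma exists_eq_C_mul_of_eq_mul {d d' : MvPolynomial (Fin (m + 1)) F} (hd : Irreducible d)
    (hd' : Irreducible d') (hdeg' : 0 < d'.degreeOf 0) {e : hatField F (m + 1)}
    (h : algebraMap _ (MvRat F (m + 1)) d = e * algebraMap _ (MvRat F (m + 1)) d') :
    ∃ a : F, a ≠ 0 ∧ d = MvPolynomial.C a * d' := by
  let _ := (hatHom (F := F) (m := m)).toAlgebra
  have := isFractionRing_hatField (F := F) (m := m)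
  have h1 : toHatPoly d = C e * toHatPoly d' := hatEmb_injective <| by
    rw [map_mul, hatEmb_toHatPoly, hatEmb_toHatPoly, hatEmb_C, h]
  have h2 : MvPolynomial.finSuccEquiv F m d' ∣ MvPolynomial.finSuccEquiv F m d :=
    (IsPrimitive.dvd_iff_fraction_map_dvd_fraction_map (K := hatField F (m + 1))
      (isPrimitive_finSuccEquiv hd' hdeg')).2
      (Dvd.intro_left _ h1.symm)
  obtain ⟨u, hu⟩ := (hd'.associated_of_dvd hd ((map_dvd_iff (MvPolynomial.finSuccEquiv F m)).1 h2))
  obtain ⟨a, ha, hau⟩ := MvPolynomial.isUnit_iff_eq_C_of_isReduced.1 u.isUnit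
  exact ⟨a, ha.ne_zero, by rw [← hu, hau, mul_comm]⟩

/-- An automorphism that together with its inverse preserves the range of an injective ring
homomorphism restricts to an automorphism of the source. -/
lemma exists_ringEquiv_comm {A L : Type*} [CommRing A] [CommRing L] {j : A →+* L}
    (hj : Function.Injective j) (g : L ≃+* L) (h : ∀ a, ∃ a', j a' = g (j a))
    (h' : ∀ a, ∃ a', j a' = g.symm (j a)) : ∃ φ : A ≃+* A, ∀ a, j (φ a) = g (j a) := by
  choose s hs using h
  choose s' hs' using h'
  exact ⟨{ toFun := s
           invFun := s'
           left_inv := fun a => hj (by rw [hs', hs, RingEquiv.symm_apply_apply])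
           right_inv := fun a => hj (by rw [hs, hs', RingEquiv.apply_symm_apply])
           map_mul' := fun a b => hj (by simp only [hs, map_mul])
           map_add' := fun a b => hj (by simp only [hs, map_add]) }, hs⟩

/-- The group of automorphisms of `F(x₁,…,xₙ)` acting on each variable by an affine
substitution `xᵢ ↦ a xᵢ + b`. -/
def affineSubgroup (F : Type*) [Field F] (n : ℕ) : Subgroup (MvRat F n ≃ₐ[F] MvRat F n) where
  carrier := {g | ∀ i, ∃ a b : F, a ≠ 0 ∧
    g (xv i) = algebraMap F (MvRat F n) a * xv i + algebraMap F (MvRat F n) b}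
  one_mem' := fun i => ⟨1, 0, one_ne_zero, by simp⟩
  mul_mem' := by
    intro g h hg hh i
    obtain ⟨a, b, ha, hab⟩ := hg i
    obtain ⟨a', b', ha', hab'⟩ := hh i
    refine ⟨a' * a, a' * b + b', mul_ne_zero ha' ha, ?_⟩
    rw [AlgEquiv.mul_apply, hab', map_add, map_mul, AlgEquiv.commutes, AlgEquiv.commutes, hab,
      map_mul, map_add, map_mul]
    ring
  inv_mem' := by
    intro g hg i
    obtain ⟨a, b, ha, hab⟩ := hg i
    refine ⟨a⁻¹, -(a⁻¹ * b), inv_ne_zero ha, ?_⟩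
    have ha0 : algebraMap F (MvRat F n) a ≠ 0 := (_root_.map_ne_zero _).2 ha
    apply g.injective
    rw [← AlgEquiv.mul_apply, mul_inv_cancel, AlgEquiv.one_apply, map_add, map_mul,
      AlgEquiv.commutes, AlgEquiv.commutes, hab, map_neg, map_mul, map_inv₀]
    field_simp
    ring

lemma affine_apply_mem_hatField {n : ℕ} [NeZero n] {g : MvRat F n ≃ₐ[F] MvRat F n}
    (hg : g ∈ affineSubgroup F n) {e : MvRat F n} (he : e ∈ hatField F n) :
    g e ∈ hatField F n := by
  have hle : hatField F n ≤ (hatField F n).comap (g : MvRat F n →+* MvRat F n) := by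
    conv_lhs => rw [hatField]
    rw [Subfield.closure_le]
    rintro _ (⟨a, rfl⟩ | ⟨i, hi, rfl⟩)
    · change g _ ∈ hatField F n
      rw [AlgEquiv.commutes]
      exact algebraMap_mem_hatField a
    · change g _ ∈ hatField F n
      obtain ⟨a, b, -, hab⟩ := hg i
      rw [hab]
      exact add_mem (mul_mem (algebraMap_mem_hatField a) (xv_mem_hatField hi))
        (algebraMap_mem_hatField b)
  exact hle he

lemma affine_exists_algebraMap {n : ℕ} {g : MvRat F n ≃ₐ[F] MvRat F n}
    (hg : g ∈ affineSubgroup F n) (p : MvPolynomial (Fin n) F) :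
    ∃ p' : MvPolynomial (Fin n) F,
      algebraMap _ (MvRat F n) p' = g (algebraMap _ (MvRat F n) p) := by
  induction p using MvPolynomial.induction_on with
  | C a => exact ⟨MvPolynomial.C a, (g.commutes a).symm⟩
  | add p q hp hq =>
    obtain ⟨p', hp'⟩ := hp
    obtain ⟨q', hq'⟩ := hq
    exact ⟨p' + q', by simp only [map_add, hp', hq']⟩
  | mul_X p i hp =>
    obtain ⟨p', hp'⟩ := hp
    obtain ⟨a, b, -, hab⟩ := hg i
    refine ⟨p' * (MvPolynomial.C a * MvPolynomial.X i + MvPolynomial.C b), ?_⟩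
    rw [map_mul, map_mul, map_mul, hp', map_add, map_mul]
    exact congrArg _ hab.symm

lemma affine_exists_hatEmb {n : ℕ} [NeZero n] {g : MvRat F n ≃ₐ[F] MvRat F n}
    (hg : g ∈ affineSubgroup F n) (p : (hatField F n)[X]) :
    ∃ p', hatEmb F n p' = g (hatEmb F n p) ∧ p'.natDegree = p.natDegree := by
  obtain ⟨a, b, ha, hab⟩ := hg 0
  let gE : hatField F n →+* hatField F n :=
    (((g : MvRat F n →+* MvRat F n).comp (hatField F n).subtype).codRestrict (hatField F n)
      fun e => affine_apply_mem_hatField hg e.2)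
  let a' : hatField F n := ⟨_, algebraMap_mem_hatField a⟩
  let b' : hatField F n := ⟨_, algebraMap_mem_hatField b⟩
  have ha' : a' ≠ 0 := fun h => ha ((map_eq_zero _).1 (congrArg Subtype.val h))
  refine ⟨(p.map gE).comp (C a' * X + C b'), ?_, ?_⟩
  · have hcomp : (hatEmb F n).comp ((compRingHom (C a' * X + C b')).comp (mapRingHom gE)) =
        (g : MvRat F n →+* MvRat F n).comp (hatEmb F n) := by
      refine Polynomial.ringHom_ext (fun e => ?_) ?_
      · simp only [RingHom.comp_apply, coe_mapRingHom, map_C, coe_compRingHom_apply, C_comp,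
          hatEmb_C]
        rfl
      · simp only [RingHom.comp_apply, coe_mapRingHom, map_X, coe_compRingHom_apply, X_comp,
          map_add, map_mul, hatEmb_C, hatEmb_X]
        exact hab.symm
    exact RingHom.congr_fun hcomp p
  · rw [natDegree_comp, natDegree_linear ha', mul_one, natDegree_map_eq_of_injective gE.injective]

lemma affine_exists_hatPoly_equiv {g : MvRat F (m + 1) ≃ₐ[F] MvRat F (m + 1)}
    (hg : g ∈ affineSubgroup F (m + 1)) :
    ∃ φ : (hatField F (m + 1))[X] ≃+* (hatField F (m + 1))[X],
      (∀ p, hatEmb F (m + 1) (φ p) = g (hatEmb F (m + 1) p)) ∧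
        ∀ p, (φ p).natDegree = p.natDegree := by
  obtain ⟨φ, hφ⟩ := exists_ringEquiv_comm hatEmb_injective g.toRingEquiv
    (fun p => (affine_exists_hatEmb hg p).imp fun _ h => h.1)
    (fun p => (affine_exists_hatEmb (inv_mem hg) p).imp fun _ h => h.1)
  refine ⟨φ, hφ, fun p => ?_⟩
  obtain ⟨p', hp', hdeg⟩ := affine_exists_hatEmb hg p
  rw [← hdeg, hatEmb_injective ((hφ p).trans hp'.symm)]

/-- A polynomial of positive degree in `x₁` proportional, over `F(x₂,…,xₙ)`, to an affine image of
another one is proportional to it over `F`. -/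
lemma exists_eq_algebraMap_mul_of_eq_mul {d d' : MvPolynomial (Fin (m + 1)) F}
    (hd : Irreducible d) (hd' : Irreducible d') (hdeg' : 0 < d'.degreeOf 0)
    {g : MvRat F (m + 1) ≃ₐ[F] MvRat F (m + 1)} (hg : g ∈ affineSubgroup F (m + 1))
    {e : MvRat F (m + 1)} (he : e ∈ hatField F (m + 1))
    (h : algebraMap _ (MvRat F (m + 1)) d = e * g (algebraMap _ (MvRat F (m + 1)) d')) :
    ∃ a : F, a ≠ 0 ∧ algebraMap _ (MvRat F (m + 1)) d =
      algebraMap F (MvRat F (m + 1)) a * g (algebraMap _ (MvRat F (m + 1)) d') := by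
  obtain ⟨φ, hφ⟩ := exists_ringEquiv_comm (IsFractionRing.injective _ (MvRat F (m + 1)))
    g.toRingEquiv (affine_exists_algebraMap hg) (affine_exists_algebraMap (inv_mem hg))
  obtain ⟨ψ, hψ, hψdeg⟩ := affine_exists_hatPoly_equiv hg
  have hdeg : 0 < (φ d').degreeOf 0 := by
    have : toHatPoly (φ d') = ψ (toHatPoly d') := hatEmb_injective <| by
      rw [hψ, hatEmb_toHatPoly, hatEmb_toHatPoly, hφ]
      rfl
    rwa [← toHatPoly_natDegree, this, hψdeg, toHatPoly_natDegree]
  have hφ' : algebraMap _ (MvRat F (m + 1)) (φ d') = g (algebraMap _ (MvRat F (m + 1)) d') := hφ d'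
  rw [← hφ'] at h ⊢
  obtain ⟨a, ha, hda⟩ := exists_eq_C_mul_of_eq_mul (e := ⟨e, he⟩) hd
    ((MulEquiv.irreducible_iff φ).2 hd') hdeg h
  exact ⟨a, ha, by rw [hda, map_mul]; rfl⟩

lemma isPolyE_iff {n : ℕ} [NeZero n] {z : MvRat F n} :
    IsPolyE (hatField F n) (xv 0) z ↔ ∃ p, hatEmb F n p = z := by
  constructor
  · rintro ⟨D, cf, rfl⟩
    exact ⟨∑ k : Fin D, C (cf k) * X ^ (k : ℕ), by simp⟩
  · rintro ⟨p, rfl⟩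
    refine ⟨p.natDegree + 1, fun k => p.coeff k, ?_⟩
    rw [hatEmb, coe_eval₂RingHom, eval₂_eq_sum_range, Finset.sum_range]
    rfl

lemma IsPolyDeg.exists_hatEmb {n : ℕ} [NeZero n] {D : ℕ} {z : MvRat F n}
    (hz : IsPolyDeg (hatField F n) (xv 0) D z) : ∃ p, hatEmb F n p = z ∧ p.degree < D := by
  obtain ⟨cf, rfl⟩ := hz
  refine ⟨∑ k : Fin D, C (cf k) * X ^ (k : ℕ), by simp, ?_⟩
  refine mem_degreeLT.1 (sum_mem fun k _ => mem_degreeLT.2 ?_)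
  exact (degree_C_mul_X_pow_le _ _).trans_lt (by exact_mod_cast k.2)

/-- Fractions with a power of an irreducible polynomial as denominator lie in the piece of the
associated monic polynomial. -/
lemma exists_monic_mem_fracPiece {q : (hatField F (m + 1))[X]} (hq : Irreducible q) :
    ∃ (p : {p : (hatField F (m + 1))[X] // p.Monic ∧ Irreducible p}) (e : hatField F (m + 1)),
      e ≠ 0 ∧ hatEmb F (m + 1) p.1 = e * hatEmb F (m + 1) q ∧
        ∀ (j : ℕ) (a : (hatField F (m + 1))[X]), a.degree < q.degree →
          hatEmb F (m + 1) a / hatEmb F (m + 1) q ^ (j + 1) ∈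
            fracPiece (hatEmb F (m + 1)) (some (p, j)) := by
  have hl : (q.leadingCoeff)⁻¹ ≠ 0 := inv_ne_zero (leadingCoeff_ne_zero.2 hq.ne_zero)
  set e := (q.leadingCoeff)⁻¹
  have hp : hatEmb F (m + 1) (q * C e) = e * hatEmb F (m + 1) q := by
    rw [map_mul, hatEmb_C, mul_comm]
  refine ⟨⟨q * C e, monic_mul_leadingCoeff_inv hq.ne_zero,
    (irreducible_mul_isUnit (isUnit_C.2 hl.isUnit)).2 hq⟩, e, hl, hp, fun j a ha => ?_⟩
  refine mem_fracPiece_some.2 ⟨C (e ^ (j + 1)) * a, ?_, ?_⟩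
  · rwa [degree_C_mul (pow_ne_zero _ hl), degree_mul_C hl]
  · have he0 : (e : MvRat F (m + 1)) ≠ 0 := fun h => hl (Subtype.ext h)
    rw [hp, map_mul, hatEmb_C, mul_pow, SubmonoidClass.coe_pow, mul_div_mul_left _ _
      (pow_ne_zero _ he0)]

/-- The indices of the pieces `a / p ^ (j + 1)` with `p` proportional to an image of `d` under
the group `G`. -/
def orbitIndex (G : Subgroup (MvRat F (m + 1) ≃ₐ[F] MvRat F (m + 1)))
    (d : MvPolynomial (Fin (m + 1)) F) (j : ℕ) :
    Set (Option ({p : (hatField F (m + 1))[X] // p.Monic ∧ Irreducible p} × ℕ)) :=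
  {i | ∃ p, i = some (p, j) ∧ ∃ g ∈ G, ∃ e ∈ hatField F (m + 1),
    hatEmb F (m + 1) p.1 = e * g (algebraMap _ (MvRat F (m + 1)) d)}

lemma MemV.mem_iSup_orbitIndex {G : Subgroup (MvRat F (m + 1) ≃ₐ[F] MvRat F (m + 1))}
    (hG : G ≤ affineSubgroup F (m + 1)) {d : MvPolynomial (Fin (m + 1)) F} (hd : Irreducible d)
    (hdeg : 0 < d.degreeOf 0) {j : ℕ} {f : MvRat F (m + 1)}
    (hf : MemV (G : Set (MvRat F (m + 1) ≃ₐ[F] MvRat F (m + 1))) (hatField F (m + 1)) (xv 0)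
      (algebraMap _ (MvRat F (m + 1)) d) (d.degreeOf 0) (j + 1) f) :
    f ∈ ⨆ i ∈ orbitIndex G d j, fracPiece (hatEmb F (m + 1)) i := by
  obtain ⟨s, hs, a, ha, rfl⟩ := hf
  refine sum_mem fun g hg => ?_
  obtain ⟨b, hb, hbdeg⟩ := (ha g hg).exists_hatEmb
  obtain ⟨φ, hφ, hφdeg⟩ := affine_exists_hatPoly_equiv (hG (hs hg))
  have hirr : Irreducible (φ (toHatPoly d)) :=
    (MulEquiv.irreducible_iff φ).2 (irreducible_toHatPoly hd hdeg)
  obtain ⟨p, e, -, hp, hmem⟩ := exists_monic_mem_fracPiece hirr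
  rw [hφ, hatEmb_toHatPoly] at hp hmem
  refine Submodule.mem_iSup_of_mem (some (p, j)) (Submodule.mem_iSup_of_mem
    ⟨p, rfl, g, hs hg, e, e.2, hp⟩ ?_)
  rw [← hb]
  refine hmem j b ?_
  rwa [degree_eq_natDegree hirr.ne_zero, hφdeg, toHatPoly_natDegree]

/-- The twisted automorphism `z ↦ a · g(z)` as an additive map. -/
noncomputable def twist {n : ℕ} (a : F) (g : MvRat F n ≃ₐ[F] MvRat F n) : MvRat F n →+ MvRat F n :=
  (AddMonoidHom.mulLeft (algebraMap F (MvRat F n) a)).comp (g : MvRat F n →+ MvRat F n)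

lemma twist_apply {n : ℕ} (a : F) (g : MvRat F n ≃ₐ[F] MvRat F n) (z : MvRat F n) :
    twist a g z = algebraMap F (MvRat F n) a * g z := rfl

lemma twist_mem_fracPiece_none {n : ℕ} [NeZero n] (a : F) {g : MvRat F n ≃ₐ[F] MvRat F n}
    (hg : g ∈ affineSubgroup F n) {z : MvRat F n} (hz : z ∈ fracPiece (hatEmb F n) none) :
    twist a g z ∈ fracPiece (hatEmb F n) none := by
  obtain ⟨p, rfl⟩ := mem_fracPiece_none.1 hz
  obtain ⟨p', hp', -⟩ := affine_exists_hatEmb hg p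
  exact mem_fracPiece_none.2 ⟨C ⟨_, algebraMap_mem_hatField a⟩ * p', by
    rw [map_mul, hatEmb_C, hp', twist_apply]⟩

lemma exists_twist_mem_fracPiece_some (a : F) {g : MvRat F (m + 1) ≃ₐ[F] MvRat F (m + 1)}
    (hg : g ∈ affineSubgroup F (m + 1))
    (p : {p : (hatField F (m + 1))[X] // p.Monic ∧ Irreducible p}) (j : ℕ) :
    ∃ p' : {p : (hatField F (m + 1))[X] // p.Monic ∧ Irreducible p},
      (∃ e ∈ hatField F (m + 1), e ≠ 0 ∧
        hatEmb F (m + 1) p'.1 = e * g (hatEmb F (m + 1) p.1)) ∧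
      ∀ z ∈ fracPiece (hatEmb F (m + 1)) (some (p, j)),
        twist a g z ∈ fracPiece (hatEmb F (m + 1)) (some (p', j)) := by
  obtain ⟨φ, hφ, hφdeg⟩ := affine_exists_hatPoly_equiv hg
  have hirr : Irreducible (φ p.1) := (MulEquiv.irreducible_iff φ).2 p.2.2
  obtain ⟨p', e, he, hp, hmem⟩ := exists_monic_mem_fracPiece hirr
  refine ⟨p', ⟨e, e.2, fun h => he (Subtype.ext h), by rw [hp, hφ]⟩, fun z hz => ?_⟩
  obtain ⟨b, hb, rfl⟩ := mem_fracPiece_some.1 hz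
  have hz' : twist a g (hatEmb F (m + 1) b / hatEmb F (m + 1) p.1 ^ (j + 1)) =
      hatEmb F (m + 1) (C ⟨_, algebraMap_mem_hatField a⟩ * φ b) /
        hatEmb F (m + 1) (φ p.1) ^ (j + 1) := by
    rw [twist_apply, map_mul, hatEmb_C, hφ, hφ, map_div₀, map_pow, mul_div_assoc]
  rw [hz']
  refine hmem j _ ((degree_mul_le _ _).trans_lt ((add_le_add degree_C_le le_rfl).trans_lt ?_))
  rw [zero_add]
  by_cases hb0 : b = 0
  · rw [hb0, map_zero, degree_zero, bot_lt_iff_ne_bot, degree_ne_bot]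
    exact hirr.ne_zero
  · have hφb : φ b ≠ 0 := (map_ne_zero_iff φ φ.injective).2 hb0
    rw [degree_eq_natDegree hφb, degree_eq_natDegree hirr.ne_zero, hφdeg, hφdeg,
      ← degree_eq_natDegree hb0, ← degree_eq_natDegree p.2.2.ne_zero]
    exact hb

lemma map_mem_biSup_of_forall_mem {ι M : Type*} [AddCommGroup M] {W : ι → Submodule ℤ M}
    {S : Set ι} (T : M →+ M) (h : ∀ i ∈ S, ∃ i' ∈ S, ∀ z ∈ W i, T z ∈ W i') :
    ∀ z ∈ ⨆ i ∈ S, W i, T z ∈ ⨆ i ∈ S, W i := by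
  have hle : ⨆ i ∈ S, W i ≤ (⨆ i ∈ S, W i).comap T.toIntLinearMap := by
    refine iSup₂_le fun i hi z hz => ?_
    obtain ⟨i', hi', hT⟩ := h i hi
    exact Submodule.mem_iSup_of_mem i' (Submodule.mem_iSup_of_mem hi' (hT z hz))
  exact hle

lemma mem_biSup_of_subset {ι M : Type*} [AddCommGroup M] {W : ι → Submodule ℤ M}
    {S S' : Set ι} (h : S ⊆ S') {z : M} (hz : z ∈ ⨆ i ∈ S, W i) : z ∈ ⨆ i ∈ S', W i :=
  (biSup_mono h : (⨆ i ∈ S, W i) ≤ ⨆ i ∈ S', W i) hz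

section Orbit

variable {G : Subgroup (MvRat F (m + 1) ≃ₐ[F] MvRat F (m + 1))}
  {g : MvRat F (m + 1) ≃ₐ[F] MvRat F (m + 1)}

lemma twist_mem_orbit (hG : G ≤ affineSubgroup F (m + 1)) (hg : g ∈ G) (a : F)
    (d : MvPolynomial (Fin (m + 1)) F) (j : ℕ) :
    ∀ z ∈ ⨆ i ∈ orbitIndex G d j, fracPiece (hatEmb F (m + 1)) i,
      twist a g z ∈ ⨆ i ∈ orbitIndex G d j, fracPiece (hatEmb F (m + 1)) i := by
  refine map_mem_biSup_of_forall_mem _ ?_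
  rintro _ ⟨p, rfl, h, hh, e, he, hp⟩
  obtain ⟨p', ⟨e', he', -, hp'⟩, hT⟩ := exists_twist_mem_fracPiece_some a (hG hg) p j
  refine ⟨some (p', j), ⟨p', rfl, g * h, mul_mem hg hh, e' * g e,
    mul_mem he' (affine_apply_mem_hatField (hG hg) he), ?_⟩, hT⟩
  rw [hp', hp, map_mul, AlgEquiv.mul_apply, mul_assoc]

lemma twist_mem_orbit_compl (hG : G ≤ affineSubgroup F (m + 1)) (hg : g ∈ G) (a : F)
    (d : MvPolynomial (Fin (m + 1)) F) (j : ℕ) :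
    ∀ z ∈ ⨆ i ∈ (orbitIndex G d j)ᶜ, fracPiece (hatEmb F (m + 1)) i,
      twist a g z ∈ ⨆ i ∈ (orbitIndex G d j)ᶜ, fracPiece (hatEmb F (m + 1)) i := by
  refine map_mem_biSup_of_forall_mem _ ?_
  rintro (_ | ⟨p, k⟩) hi
  · exact ⟨none, hi, fun z hz => twist_mem_fracPiece_none a (hG hg) hz⟩
  obtain ⟨p', ⟨e', he', he0, hp'⟩, hT⟩ := exists_twist_mem_fracPiece_some a (hG hg) p k
  refine ⟨some (p', k), fun ⟨p'', h, g', hg', e, he, hp''⟩ => hi ?_, hT⟩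
  obtain ⟨rfl, rfl⟩ := Prod.mk.inj (Option.some.inj h)
  have hginv := inv_mem hg
  refine ⟨p, rfl, g⁻¹ * g', mul_mem hginv hg', g⁻¹ (e'⁻¹ * e),
    affine_apply_mem_hatField (hG hginv) (mul_mem (inv_mem he') he), g.injective ?_⟩
  have hgg : ∀ z, g (g⁻¹ z) = z := fun z => by
    rw [← AlgEquiv.mul_apply, mul_inv_cancel, AlgEquiv.one_apply]
  rw [map_mul, AlgEquiv.mul_apply, hgg, hgg, mul_assoc, ← hp'', hp', inv_mul_cancel_left₀ he0]

lemma twist_mem_fracPiece_compl_none (hg : g ∈ affineSubgroup F (m + 1)) (a : F) :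
    ∀ z ∈ ⨆ i ∈ ({none}ᶜ : Set _), fracPiece (hatEmb F (m + 1)) i,
      twist a g z ∈ ⨆ i ∈ ({none}ᶜ : Set _), fracPiece (hatEmb F (m + 1)) i := by
  refine map_mem_biSup_of_forall_mem _ ?_
  rintro (_ | ⟨p, k⟩) hi
  · exact absurd rfl hi
  obtain ⟨p', -, hT⟩ := exists_twist_mem_fracPiece_some a hg p k
  exact ⟨some (p', k), Option.some_ne_none _, hT⟩

/-- Index sets of orbits that are not `G`-equivalent are disjoint. -/
lemma gEquivSet_of_mem_orbitIndex (hG : G ≤ affineSubgroup F (m + 1))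
    {d d' : MvPolynomial (Fin (m + 1)) F} (hd : Irreducible d) (hd' : Irreducible d')
    (hdeg' : 0 < d'.degreeOf 0) {j j' : ℕ}
    {i : Option ({p : (hatField F (m + 1))[X] // p.Monic ∧ Irreducible p} × ℕ)}
    (hi : i ∈ orbitIndex G d j) (hi' : i ∈ orbitIndex G d' j') :
    j = j' ∧ GEquivSet (G : Set (MvRat F (m + 1) ≃ₐ[F] MvRat F (m + 1)))
      (algebraMap _ (MvRat F (m + 1)) d) (algebraMap _ (MvRat F (m + 1)) d') := by
  obtain ⟨p, rfl, g, hg, e, he, hp⟩ := hi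
  obtain ⟨p', h, g', hg', e', he', hp'⟩ := hi'
  obtain ⟨rfl, rfl⟩ := Prod.mk.inj (Option.some.inj h)
  have he0 : e ≠ 0 := by
    rintro rfl
    rw [zero_mul, map_eq_zero_iff _ hatEmb_injective] at hp
    exact p.2.2.ne_zero hp
  have hginv := inv_mem hg
  have hgg : ∀ z, g (g⁻¹ z) = z := fun z => by
    rw [← AlgEquiv.mul_apply, mul_inv_cancel, AlgEquiv.one_apply]
  obtain ⟨a, ha, h⟩ := exists_eq_algebraMap_mul_of_eq_mul hd hd' hdeg'
    (hG (mul_mem hginv hg')) (e := g⁻¹ (e⁻¹ * e'))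
    (affine_apply_mem_hatField (hG hginv) (mul_mem (inv_mem he) he')) <| g.injective <| by
      rw [map_mul, AlgEquiv.mul_apply, hgg, hgg, mul_assoc, ← hp', hp, inv_mul_cancel_left₀ he0]
  exact ⟨rfl, a, ha, _, mul_mem hginv hg', h⟩

end Orbit

end RationalFunctions

set_option maxHeartbeats 1000000 in
/-- **Lemma: summability respects the orbital decomposition.** Let
`f = f₀ + Σ_t f_t` be the orbital decomposition of `f ∈ F(x)` (so `f₀ ∈ F(x̂₁)[x₁]` and the
`f_t` lie in pairwise distinct spaces `V_{[d_t]_G, j_t}`), and let `c₁,…,cₙ ∈ F` be nonzero.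
Then `f` is `(c₁θ_{x₁},…,cₙθ_{xₙ})`-summable iff `f₀` is `(c₁θ_{x₁},…,cₙθ_{xₙ})`-summable
with witnesses in `F(x̂₁)[x₁]` and every component `f_t` is `(c₁θ_{x₁},…,cₙθ_{xₙ})`-summable
in `F(x)`. -/
theorem stmt_1 {F : Type*} [Field F] [CharZero F] {n : ℕ} [NeZero n]
    (q : F) (hq0 : q ≠ 0) (hq : ∀ m : ℤ, m ≠ 0 → q ^ m ≠ 1)
    (θ : Fin n → (MvRat F n ≃ₐ[F] MvRat F n))
    (hθfix : ∀ i l : Fin n, i ≠ l → θ i (xv l) = xv l)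
    (hθ : ∀ i : Fin n,
      θ i (xv i) = xv i + 1 ∨ θ i (xv i) = algebraMap F (MvRat F n) q * xv i)
    (c : Fin n → F) (hc : ∀ i, c i ≠ 0)
    (f f0 : MvRat F n) (hf0 : IsPolyE (hatField F n) (xv 0) f0)
    (s : ℕ) (d : Fin s → MvPolynomial (Fin n) F) (jj : Fin s → ℕ) (fc : Fin s → MvRat F n)
    (hd : ∀ t, Irreducible (d t)) (hdeg : ∀ t, 0 < (d t).degreeOf 0) (hjj : ∀ t, 1 ≤ jj t)
    (hfc : ∀ t, MemV (F := F) (L := MvRat F n) (↑(Subgroup.closure (Set.range θ)))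
      (hatField F n) (xv 0) (algebraMap (MvPolynomial (Fin n) F) (MvRat F n) (d t))
      ((d t).degreeOf 0) (jj t) (fc t))
    (hdistinct : ∀ t t' : Fin s, t ≠ t' →
      ¬(jj t = jj t' ∧ GEquivSet (F := F) (L := MvRat F n)
        (↑(Subgroup.closure (Set.range θ)))
        (algebraMap (MvPolynomial (Fin n) F) (MvRat F n) (d t))
        (algebraMap (MvPolynomial (Fin n) F) (MvRat F n) (d t'))))
    (hdecomp : f = f0 + ∑ t : Fin s, fc t) :
    (∃ g : Fin n → MvRat F n,
        f = ∑ i : Fin n, (algebraMap F (MvRat F n) (c i) * θ i (g i) - g i)) ↔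
    ((∃ g : Fin n → MvRat F n, (∀ i, IsPolyE (hatField F n) (xv 0) (g i)) ∧
        f0 = ∑ i : Fin n, (algebraMap F (MvRat F n) (c i) * θ i (g i) - g i)) ∧
      ∀ t : Fin s, ∃ g : Fin n → MvRat F n,
        fc t = ∑ i : Fin n, (algebraMap F (MvRat F n) (c i) * θ i (g i) - g i)) := by
  obtain ⟨m, rfl⟩ : ∃ m, n = m + 1 := Nat.exists_eq_succ_of_ne_zero (NeZero.ne n)
  set G := Subgroup.closure (Set.range θ)
  have hG : G ≤ affineSubgroup F (m + 1) := by
    refine (Subgroup.closure_le _).2 ?_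
    rintro _ ⟨i, rfl⟩ l
    by_cases hil : i = l
    · subst hil
      rcases hθ i with h | h
      · exact ⟨1, 1, one_ne_zero, by simp [h]⟩
      · exact ⟨q, 0, hq0, by simp [h]⟩
    · exact ⟨1, 0, one_ne_zero, by simp [hθfix i l hil]⟩
  have hθG : ∀ i, θ i ∈ G := fun i => Subgroup.subset_closure ⟨i, rfl⟩
  have hcompl := isCompl_biSup_fracPiece (hatEmb_injective (F := F) (m := m)) exists_hatEmb_div
  have hfcS : ∀ t, fc t ∈ ⨆ i ∈ orbitIndex G (d t) (jj t - 1),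
      fracPiece (hatEmb F (m + 1)) i := fun t => by
    refine MemV.mem_iSup_orbitIndex hG (hd t) (hdeg t) ?_
    rw [Nat.sub_add_cancel (hjj t)]
    exact hfc t
  have hf0S : f0 ∈ fracPiece (hatEmb F (m + 1)) none := mem_fracPiece_none.2 (isPolyE_iff.1 hf0)
  constructor
  · rintro ⟨g, hg⟩
    refine ⟨?_, fun t => ?_⟩
    · have hrest : ∑ t, fc t ∈ ⨆ i ∈ ({none}ᶜ : Set _), fracPiece (hatEmb F (m + 1)) i := by
        refine sum_mem fun t _ => mem_biSup_of_subset ?_ (hfcS t)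
        rintro _ ⟨p, rfl, -⟩
        exact Option.some_ne_none _
      have h0 := hcompl {none}
      rw [iSup_singleton] at h0
      obtain ⟨g', hg'U, hg'⟩ := exists_sum_sub_of_isCompl h0 (fun i => twist (c i) (θ i))
        (fun i z hz => twist_mem_fracPiece_none (c i) (hG (hθG i)) hz)
        (fun i => twist_mem_fracPiece_compl_none (hG (hθG i)) (c i)) hf0S hrest g
        (hdecomp.symm.trans hg)
      exact ⟨g', fun i => isPolyE_iff.2 (mem_fracPiece_none.1 (hg'U i)), hg'⟩
    · have hrest : f0 + ∑ t' ∈ Finset.univ.erase t, fc t' ∈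
          ⨆ i ∈ (orbitIndex G (d t) (jj t - 1))ᶜ, fracPiece (hatEmb F (m + 1)) i := by
        refine add_mem (Submodule.mem_iSup_of_mem none (Submodule.mem_iSup_of_mem ?_ hf0S))
          (sum_mem fun t' ht' => mem_biSup_of_subset (fun i hi' hi => ?_) (hfcS t'))
        · rintro ⟨p, h, -⟩
          exact (Option.some_ne_none _) h.symm
        · obtain ⟨hj, hequiv⟩ := gEquivSet_of_mem_orbitIndex hG (hd t) (hd t') (hdeg t') hi hi'
          have h1 := hjj t
          have h2 := hjj t'
          exact hdistinct t t' (Finset.ne_of_mem_erase ht').symm ⟨by lia, hequiv⟩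
      obtain ⟨g', -, hg'⟩ := exists_sum_sub_of_isCompl
        (hcompl (orbitIndex G (d t) (jj t - 1))) (fun i => twist (c i) (θ i))
        (fun i => twist_mem_orbit hG (hθG i) (c i) (d t) (jj t - 1))
        (fun i => twist_mem_orbit_compl hG (hθG i) (c i) (d t) (jj t - 1)) (hfcS t) hrest g (by
          rw [add_left_comm, Finset.add_sum_erase _ _ (Finset.mem_univ t), ← hdecomp]
          exact hg)
      exact ⟨g', hg'⟩
  · rintro ⟨⟨g, -, hg⟩, h⟩
    choose k hk using h
    refine ⟨fun i => g i + ∑ t, k t i, ?_⟩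
    rw [hdecomp, hg, Finset.sum_congr rfl fun t _ => hk t, Finset.sum_comm,
      ← Finset.sum_add_distrib]
    refine Finset.sum_congr rfl fun i _ => ?_
    rw [map_add, map_sum, mul_add, Finset.mul_sum, Finset.sum_sub_distrib]
    ring
end

section
/- Let n > 1, let f = a/d^j ∈ F(x) with j ≥ 1, a ∈ F(x̂₁)[x₁], d ∈ F[x] irreducible and normal with respect to θ_{x₁}, and deg_{x₁}(a) < deg_{x₁}(d). Let H = ⟨θ_{x₁},…,θ_{x_{n−1}}⟩ and suppose rank G_d/H_d = 0, i.e., G_d = H_d. Let c₁,…,cₙ ∈ F be nonzero and θ̃_{x_i} = c_i·θ_{x_i}. Then f is (θ̃_{x₁},…,θ̃_{xₙ})-summable in F(x) if and only if f is (θ̃_{x₁},…,θ̃_{x_{n−1}})-summable in F(x). -/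
open Polynomial in
/-- A polynomial over `K = Frac B` becomes integral after multiplication by some `b ≠ 0`. -/
theorem Polynomial.exists_map_eq_C_mul {B : Type*} [CommRing B] [IsDomain B]
    (p : (FractionRing B)[X]) :
    ∃ b : B, b ≠ 0 ∧ ∃ p' : B[X],
      p'.map (algebraMap B (FractionRing B)) = C (algebraMap B (FractionRing B) b) * p := by
  obtain ⟨b, hb, h⟩ := IsLocalization.integerNormalization_spec (nonZeroDivisors B) p
  refine ⟨b, nonZeroDivisors.ne_zero hb, _, h.trans ?_⟩
  rw [← IsScalarTower.algebraMap_smul (FractionRing B) b p, smul_eq_C_mul]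

open Polynomial in
/-- Bézout relation, up to a nonzero constant, between an irreducible polynomial of positive
degree and a polynomial it does not divide. -/
theorem Polynomial.exists_mul_add_mul_eq_C {B : Type*} [CommRing B] [IsDomain B]
    [UniqueFactorizationMonoid B] {p t : B[X]} (hp : Irreducible p) (hdeg : p.natDegree ≠ 0)
    (ht : ¬ p ∣ t) : ∃ u v : B[X], ∃ e : B, e ≠ 0 ∧ u * p + v * t = C e := by
  obtain ⟨_⟩ : Nonempty (NormalizedGCDMonoid B) := inferInstance
  have hprim : p.IsPrimitive := hp.isPrimitive hdeg
  have hirr := (hprim.irreducible_iff_irreducible_map_fraction_map (K := FractionRing B)).1 hp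
  have hndvd : ¬ p.map (algebraMap B (FractionRing B)) ∣ t.map (algebraMap B (FractionRing B)) :=
    fun h => ht (hprim.dvd_of_fraction_map_dvd_fraction_map h)
  obtain ⟨u, v, huv⟩ := (hirr.coprime_iff_not_dvd (n := t.map _)).2 hndvd
  obtain ⟨b, hb, u', hu⟩ := exists_map_eq_C_mul u
  obtain ⟨c, hc, v', hv⟩ := exists_map_eq_C_mul v
  refine ⟨C c * u', C b * v', b * c, mul_ne_zero hb hc,
    map_injective _ (IsFractionRing.injective B (FractionRing B)) ?_⟩
  simp only [Polynomial.map_add, Polynomial.map_mul, map_C, hu, hv, map_mul]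
  linear_combination (C (algebraMap B (FractionRing B) b) * C (algebraMap B (FractionRing B) c)) *
    huv

open Polynomial in
/-- Pseudo-division: division with remainder up to a nonzero constant. -/
theorem Polynomial.exists_C_mul_eq_mul_add {B : Type*} [CommRing B] [IsDomain B]
    (p : B[X]) {s : B[X]} (hs : s ≠ 0) :
    ∃ w r : B[X], ∃ e : B, e ≠ 0 ∧ C e * p = w * s + r ∧ r.degree < s.degree := by
  set φ := algebraMap B (FractionRing B)
  have hφ : Function.Injective φ := IsFractionRing.injective B (FractionRing B)
  obtain ⟨b, hb, w, hw⟩ := exists_map_eq_C_mul (p.map φ / s.map φ)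
  replace hw : w.map φ = C (φ b) * (p.map φ / s.map φ) := hw
  refine ⟨w, C b * p - w * s, b, hb, by ring, ?_⟩
  have hs' : s.map φ ≠ 0 := (Polynomial.map_ne_zero_iff hφ).2 hs
  have key : (C b * p - w * s).map φ = C (φ b) * (p.map φ % s.map φ) := by
    simp only [Polynomial.map_sub, Polynomial.map_mul, map_C, hw]
    linear_combination -C (φ b) * EuclideanDomain.div_add_mod (p.map φ) (s.map φ)
  rw [← degree_map_eq_of_injective hφ, ← degree_map_eq_of_injective hφ s, key,
    degree_C_mul (by simpa using (map_ne_zero_iff φ hφ).2 hb)]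
  exact EuclideanDomain.mod_lt _ hs'

section PolarParts

open MvPolynomial

variable {F : Type*} [Field F] {m : ℕ}

/-- The degree in the variable `x₁` (of index `0`), with value `⊥` at `0`. -/
noncomputable def x0deg (p : MvPolynomial (Fin (m + 1)) F) : WithBot ℕ :=
  (finSuccEquiv F m p).degree

theorem x0deg_mul (p r : MvPolynomial (Fin (m + 1)) F) : x0deg (p * r) = x0deg p + x0deg r := by
  simp [x0deg]

theorem x0deg_add_le (p r : MvPolynomial (Fin (m + 1)) F) :
    x0deg (p + r) ≤ max (x0deg p) (x0deg r) := by
  simpa [x0deg] using Polynomial.degree_add_le _ _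

theorem x0deg_one : x0deg (1 : MvPolynomial (Fin (m + 1)) F) = 0 := by
  simp [x0deg]

theorem x0deg_eq_bot {p : MvPolynomial (Fin (m + 1)) F} : x0deg p = ⊥ ↔ p = 0 := by
  simp [x0deg]

theorem x0deg_eq_degreeOf {p : MvPolynomial (Fin (m + 1)) F} (hp : p ≠ 0) :
    x0deg p = p.degreeOf 0 :=
  degree_finSuccEquiv hp

theorem x0deg_of_degreeOf_eq_zero {p : MvPolynomial (Fin (m + 1)) F} (hp : p ≠ 0)
    (h : p.degreeOf 0 = 0) : x0deg p = 0 := by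
  rw [x0deg_eq_degreeOf hp, h]; rfl

theorem ne_zero_of_x0deg_eq_zero {e : MvPolynomial (Fin (m + 1)) F} (he : x0deg e = 0) :
    e ≠ 0 := by
  rintro rfl
  simp [x0deg] at he

theorem not_dvd_of_x0deg_eq_zero {a e : MvPolynomial (Fin (m + 1)) F} (ha : 0 < x0deg a)
    (he : x0deg e = 0) : ¬ a ∣ e := by
  rintro ⟨b, rfl⟩
  have hb : b ≠ 0 := right_ne_zero_of_mul (ne_zero_of_x0deg_eq_zero he)
  have ha' : a ≠ 0 := left_ne_zero_of_mul (ne_zero_of_x0deg_eq_zero he)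
  rw [x0deg_mul] at he
  rw [x0deg_eq_degreeOf hb, x0deg_eq_degreeOf ha'] at *
  norm_cast at he ha
  omega

theorem x0deg_finSuccEquiv_symm_C {e : MvPolynomial (Fin m) F} (he : e ≠ 0) :
    x0deg ((finSuccEquiv F m).symm (Polynomial.C e)) = 0 := by
  simp [x0deg, Polynomial.degree_C he]

theorem exists_mul_add_mul_x0deg_eq_zero {p t : MvPolynomial (Fin (m + 1)) F}
    (hp : Irreducible p) (hdeg : 0 < x0deg p) (ht : ¬ p ∣ t) :
    ∃ u v e : MvPolynomial (Fin (m + 1)) F, x0deg e = 0 ∧ u * p + v * t = e := by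
  obtain ⟨u, v, e, he, h⟩ := Polynomial.exists_mul_add_mul_eq_C
    (p := finSuccEquiv F m p) (t := finSuccEquiv F m t)
    ((MulEquiv.irreducible_iff (finSuccEquiv F m)).2 hp)
    (Polynomial.natDegree_pos_iff_degree_pos.2 hdeg).ne'
    (by rwa [map_dvd_iff])
  refine ⟨(finSuccEquiv F m).symm u, (finSuccEquiv F m).symm v, _,
    x0deg_finSuccEquiv_symm_C he, (finSuccEquiv F m).injective ?_⟩
  simpa using h

theorem exists_mul_eq_mul_add_x0deg_lt (p : MvPolynomial (Fin (m + 1)) F)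
    {s : MvPolynomial (Fin (m + 1)) F} (hs : s ≠ 0) :
    ∃ w r e : MvPolynomial (Fin (m + 1)) F,
      x0deg e = 0 ∧ e * p = w * s + r ∧ x0deg r < x0deg s := by
  obtain ⟨w, r, e, he, h, hr⟩ := Polynomial.exists_C_mul_eq_mul_add (finSuccEquiv F m p)
    (s := finSuccEquiv F m s) (by simpa using hs)
  refine ⟨(finSuccEquiv F m).symm w, (finSuccEquiv F m).symm r, _,
    x0deg_finSuccEquiv_symm_C he, (finSuccEquiv F m).injective ?_, by simpa [x0deg] using hr⟩
  simpa using h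

/-- `A` consists of irreducible polynomials of positive degree in `x₁`. -/
def IsPolarSet (A : Set (MvPolynomial (Fin (m + 1)) F)) : Prop :=
  ∀ a ∈ A, Irreducible a ∧ 0 < x0deg a

/-- `t` is nonzero and divisible by no element of `A`. -/
def AvoidsSet (A : Set (MvPolynomial (Fin (m + 1)) F)) (t : MvPolynomial (Fin (m + 1)) F) : Prop :=
  t ≠ 0 ∧ ∀ a ∈ A, ¬ a ∣ t

variable {A : Set (MvPolynomial (Fin (m + 1)) F)}

theorem AvoidsSet.mul (hA : IsPolarSet A) {t t' : MvPolynomial (Fin (m + 1)) F}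
    (ht : AvoidsSet A t) (ht' : AvoidsSet A t') : AvoidsSet A (t * t') :=
  ⟨mul_ne_zero ht.1 ht'.1, fun a ha h =>
    ((hA a ha).1.prime.dvd_or_dvd h).elim (ht.2 a ha) (ht'.2 a ha)⟩

theorem AvoidsSet.of_x0deg_eq_zero (hA : IsPolarSet A) {e : MvPolynomial (Fin (m + 1)) F}
    (he : x0deg e = 0) : AvoidsSet A e :=
  ⟨ne_zero_of_x0deg_eq_zero he, fun a ha => not_dvd_of_x0deg_eq_zero (hA a ha).2 he⟩

theorem AvoidsSet.one (hA : IsPolarSet A) : AvoidsSet A 1 := .of_x0deg_eq_zero hA x0deg_one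

theorem ne_zero_of_mem_closure (hA : IsPolarSet A) {s : MvPolynomial (Fin (m + 1)) F}
    (hs : s ∈ Submonoid.closure A) : s ≠ 0 := by
  induction hs using Submonoid.closure_induction with
  | mem a ha => exact (hA a ha).1.ne_zero
  | one => exact one_ne_zero
  | mul a b _ _ ha hb => exact mul_ne_zero ha hb

theorem exists_eq_mul_of_isPolarSet (hA : IsPolarSet A) (r : MvPolynomial (Fin (m + 1)) F)
    (hr : r ≠ 0) : ∃ s ∈ Submonoid.closure A, ∃ t, AvoidsSet A t ∧ r = s * t := by
  induction r using UniqueFactorizationMonoid.induction_on_prime with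
  | h₁ => exact absurd rfl hr
  | h₂ u hu =>
    exact ⟨1, one_mem _, u, ⟨hr, fun a ha h => (hA a ha).1.not_isUnit (isUnit_of_dvd_unit h hu)⟩,
      (one_mul u).symm⟩
  | h₃ r p hr' hp ih =>
    obtain ⟨s, hs, t, ht, rfl⟩ := ih hr'
    by_cases h : ∃ a ∈ A, a ∣ p
    · obtain ⟨a, ha, hap⟩ := h
      obtain ⟨u, rfl⟩ := (hA a ha).1.associated_of_dvd hp.irreducible hap
      refine ⟨a * s, mul_mem (Submonoid.subset_closure ha) hs, u * t, ⟨?_, ?_⟩, by ring⟩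
      · exact mul_ne_zero u.isUnit.ne_zero ht.1
      · intro b hb hbt
        exact ht.2 b hb ((Units.dvd_mul_left).1 hbt)
    · push Not at h
      exact ⟨s, hs, p * t, AvoidsSet.mul hA ⟨hp.ne_zero, h⟩ ht, by ring⟩

theorem exists_mul_add_mul_of_mem_closure (hA : IsPolarSet A)
    {s t : MvPolynomial (Fin (m + 1)) F} (hs : s ∈ Submonoid.closure A) (ht : AvoidsSet A t) :
    ∃ u v e : MvPolynomial (Fin (m + 1)) F, x0deg e = 0 ∧ u * s + v * t = e := by
  induction hs using Submonoid.closure_induction with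
  | mem a ha => exact exists_mul_add_mul_x0deg_eq_zero (hA a ha).1 (hA a ha).2 (ht.2 a ha)
  | one => exact ⟨1, 0, 1, x0deg_one, by ring⟩
  | mul a b _ _ iha ihb =>
    obtain ⟨u, v, e, he, h⟩ := iha
    obtain ⟨u', v', e', he', h'⟩ := ihb
    exact ⟨u * u', v * u' * b + u * a * v' + v * v' * t, e * e', by simp [x0deg_mul, he, he'],
      by rw [← h, ← h']; ring⟩

theorem dvd_of_dvd_mul_of_mem_closure (hA : IsPolarSet A)
    {s t : MvPolynomial (Fin (m + 1)) F} (hs : s ∈ Submonoid.closure A) (ht : AvoidsSet A t)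
    {p : MvPolynomial (Fin (m + 1)) F} (h : s ∣ p * t) : s ∣ p := by
  induction hs using Submonoid.closure_induction generalizing p with
  | mem a ha => exact ((hA a ha).1.prime.dvd_or_dvd h).resolve_right (ht.2 a ha)
  | one => exact one_dvd p
  | mul a b ha _ iha ihb =>
    obtain ⟨p', rfl⟩ := iha (dvd_of_mul_right_dvd h)
    rw [mul_assoc] at h
    exact mul_dvd_mul_left a
      (ihb ((mul_dvd_mul_iff_left (ne_zero_of_mem_closure hA ha)).1 h))

local notation "ι" => algebraMap (MvPolynomial (Fin (m + 1)) F) (MvRat F (m + 1))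

theorem algebraMap_mvRat_ne_zero {p : MvPolynomial (Fin (m + 1)) F} (hp : p ≠ 0) : ι p ≠ 0 :=
  (map_ne_zero_iff _ (IsFractionRing.injective _ _)).2 hp

/-- The rational functions without poles along `A`. -/
def regularPart (hA : IsPolarSet A) : Submodule F (MvRat F (m + 1)) where
  carrier := {g | ∃ p t, AvoidsSet A t ∧ g = ι p / ι t}
  zero_mem' := ⟨0, 1, .one hA, by simp⟩
  add_mem' := by
    rintro _ _ ⟨p, t, ht, rfl⟩ ⟨p', t', ht', rfl⟩
    refine ⟨p * t' + t * p', t * t', ht.mul hA ht', ?_⟩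
    rw [div_add_div _ _ (algebraMap_mvRat_ne_zero ht.1) (algebraMap_mvRat_ne_zero ht'.1)]
    simp
  smul_mem' := by
    rintro c _ ⟨p, t, ht, rfl⟩
    refine ⟨C c * p, t, ht, ?_⟩
    rw [Algebra.smul_def, IsScalarTower.algebraMap_apply F (MvPolynomial (Fin (m + 1)) F),
      MvPolynomial.algebraMap_eq, map_mul, mul_div_assoc]

/-- The rational functions that are proper in `x₁`, with poles (in `x₁`) only along `A`. -/
def polarPart (hA : IsPolarSet A) : Submodule F (MvRat F (m + 1)) where
  carrier := {g | ∃ p, ∃ s ∈ Submonoid.closure A, ∃ e, x0deg e = 0 ∧ x0deg p < x0deg s ∧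
    g = ι p / ι (s * e)}
  zero_mem' := ⟨0, 1, one_mem _, 1, x0deg_one, by simp [x0deg], by simp⟩
  add_mem' := by
    rintro _ _ ⟨p, s, hs, e, he, hps, rfl⟩ ⟨p', s', hs', e', he', hps', rfl⟩
    have hs0 := ne_zero_of_mem_closure hA hs
    have hs0' := ne_zero_of_mem_closure hA hs'
    refine ⟨p * (s' * e') + (s * e) * p', s * s', mul_mem hs hs', e * e',
      by simp [x0deg_mul, he, he'], (x0deg_add_le _ _).trans_lt (max_lt ?_ ?_), ?_⟩
    · simpa [x0deg_mul, he'] using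
        WithBot.add_lt_add_right (by simpa [x0deg_eq_bot] using hs0') hps
    · simpa [x0deg_mul, he] using
        WithBot.add_lt_add_left (by simpa [x0deg_eq_bot] using hs0) hps'
    · rw [div_add_div _ _
        (algebraMap_mvRat_ne_zero (mul_ne_zero hs0 (ne_zero_of_x0deg_eq_zero he)))
        (algebraMap_mvRat_ne_zero (mul_ne_zero hs0' (ne_zero_of_x0deg_eq_zero he')))]
      simp only [map_add, map_mul]
      ring
  smul_mem' := by
    rintro c _ ⟨p, s, hs, e, he, hps, rfl⟩
    refine ⟨C c * p, s, hs, e, he, ?_, ?_⟩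
    · rw [← MvPolynomial.smul_eq_C_mul]
      exact lt_of_le_of_lt (by simpa [x0deg] using Polynomial.degree_smul_le c _) hps
    · rw [Algebra.smul_def, IsScalarTower.algebraMap_apply F (MvPolynomial (Fin (m + 1)) F),
        MvPolynomial.algebraMap_eq, map_mul ι (C c) p, mul_div_assoc]

theorem isCompl_polarPart_regularPart (hA : IsPolarSet A) :
    IsCompl (polarPart hA) (regularPart hA) := by
  constructor
  · rw [Submodule.disjoint_def]
    rintro _ ⟨p, s, hs, e, he, hps, rfl⟩ ⟨r, t, ht, h⟩
    have hse := mul_ne_zero (ne_zero_of_mem_closure hA hs) (ne_zero_of_x0deg_eq_zero he)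
    rw [div_eq_div_iff (algebraMap_mvRat_ne_zero hse) (algebraMap_mvRat_ne_zero ht.1),
      ← map_mul, ← map_mul, (IsFractionRing.injective _ _).eq_iff] at h
    have hdvd : s ∣ p := dvd_of_dvd_mul_of_mem_closure hA hs ht ⟨r * e, by rw [h]; ring⟩
    have hp : p = 0 := by
      obtain ⟨w, rfl⟩ := hdvd
      by_contra hne
      rw [x0deg_mul, x0deg_eq_degreeOf (left_ne_zero_of_mul hne),
        x0deg_eq_degreeOf (right_ne_zero_of_mul hne)] at hps
      norm_cast at hps
      omega
    simp [hp]
  · rw [codisjoint_iff, eq_top_iff]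
    rintro g -
    obtain ⟨p, r, hr, rfl⟩ := IsFractionRing.div_surjective (A := MvPolynomial (Fin (m + 1)) F) g
    obtain ⟨s, hs, t, ht, rfl⟩ := exists_eq_mul_of_isPolarSet hA r (nonZeroDivisors.ne_zero hr)
    obtain ⟨u, v, e, he, huv⟩ := exists_mul_add_mul_of_mem_closure hA hs ht
    have hs0 := ne_zero_of_mem_closure hA hs
    obtain ⟨w, z, e', he', hdiv, hz⟩ := exists_mul_eq_mul_add_x0deg_lt (p * v) hs0
    refine Submodule.mem_sup.2 ⟨ι z / ι (s * (e * e')), ⟨z, s, hs, e * e', ?_, hz, rfl⟩,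
      ι (p * u * e' + w * t) / ι (t * (e * e')), ⟨_, _, ht.mul hA (.of_x0deg_eq_zero hA ?_), rfl⟩,
      ?_⟩
    · simp [x0deg_mul, he, he']
    · simp [x0deg_mul, he, he']
    have h1 := algebraMap_mvRat_ne_zero hs0
    have h2 := algebraMap_mvRat_ne_zero ht.1
    have h3 := algebraMap_mvRat_ne_zero (ne_zero_of_x0deg_eq_zero he)
    have h4 := algebraMap_mvRat_ne_zero (ne_zero_of_x0deg_eq_zero he')
    have huv' := congrArg ι huv
    have hdiv' := congrArg ι hdiv
    simp only [map_add, map_mul] at huv' hdiv' ⊢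
    field_simp
    linear_combination (-ι t) * hdiv' + ι p * ι e' * huv'

/-- The projection of a rational function to its polar part along `A`. -/
noncomputable def polarProj (hA : IsPolarSet A) : MvRat F (m + 1) →ₗ[F] MvRat F (m + 1) :=
  (polarPart hA).projection (regularPart hA) (isCompl_polarPart_regularPart hA)

theorem mem_polarPart_of_x0deg_lt (hA : IsPolarSet A) {p d e : MvPolynomial (Fin (m + 1)) F}
    (hd : d ∈ A) {j : ℕ} (hj : 1 ≤ j) (he : x0deg e = 0) (hp : x0deg p < x0deg d) :
    ι p / ι (d ^ j * e) ∈ polarPart hA := by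
  refine ⟨p, d ^ j, pow_mem (Submonoid.subset_closure hd) j, e, he, hp.trans_le ?_, rfl⟩
  have hd0 := (hA d hd).1.ne_zero
  rw [x0deg_eq_degreeOf hd0, x0deg_eq_degreeOf (pow_ne_zero j hd0),
    degreeOf_pow_eq _ _ _ hd0]
  exact_mod_cast Nat.le_mul_of_pos_left _ hj

variable (F m) in
/-- The automorphisms of `F(x)` that preserve `F[x]` and the degree in `x₁`. -/
def x0degAut : Subgroup (MvRat F (m + 1) ≃ₐ[F] MvRat F (m + 1)) where
  carrier := {T | ∃ σ : MvPolynomial (Fin (m + 1)) F ≃ₐ[F] MvPolynomial (Fin (m + 1)) F,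
    (∀ p, ι (σ p) = T (ι p)) ∧ ∀ p, x0deg (σ p) = x0deg p}
  one_mem' := ⟨1, by simp, by simp⟩
  mul_mem' := by
    rintro T T' ⟨σ, h, hdeg⟩ ⟨σ', h', hdeg'⟩
    exact ⟨σ * σ', by simp [h, h'], by simp [hdeg, hdeg']⟩
  inv_mem' := by
    rintro T ⟨σ, h, hdeg⟩
    refine ⟨σ⁻¹, fun p => ?_, fun p => ?_⟩
    · apply T.injective
      rw [← h, ← AlgEquiv.mul_apply, ← AlgEquiv.mul_apply, mul_inv_cancel, mul_inv_cancel]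
      rfl
    · rw [← hdeg, ← AlgEquiv.mul_apply, mul_inv_cancel, AlgEquiv.one_apply]

theorem map_polarProj {A A' : Set (MvPolynomial (Fin (m + 1)) F)} (hA : IsPolarSet A)
    (hA' : IsPolarSet A') {T : MvRat F (m + 1) ≃ₐ[F] MvRat F (m + 1)}
    (hT : T ∈ x0degAut F m) (hAA' : ∀ a b, ι b = T (ι a) → (b ∈ A' ↔ a ∈ A))
    (g : MvRat F (m + 1)) : T (polarProj hA g) = polarProj hA' (T g) := by
  obtain ⟨σ, hσ, hdeg⟩ := hT
  have hmem : ∀ a, σ a ∈ A' ↔ a ∈ A := fun a => hAA' a (σ a) (hσ a)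
  have hpol : T (polarProj hA g) ∈ polarPart hA' := by
    obtain ⟨p, s, hs, e, he, hps, h⟩ :=
      Submodule.projection_apply_mem (isCompl_polarPart_regularPart hA) g
    refine ⟨σ p, σ s, ?_, σ e, by rw [hdeg, he], by rwa [hdeg, hdeg], ?_⟩
    · have : Submonoid.closure A ≤ (Submonoid.closure A').comap (σ : _ →* _) :=
        Submonoid.closure_le.2 fun a ha => Submonoid.subset_closure ((hmem a).2 ha)
      exact this hs
    · rw [polarProj, h, map_div₀, ← hσ, ← hσ, map_mul σ]
  have hreg : T (g - polarProj hA g) ∈ regularPart hA' := by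
    obtain ⟨p, t, ht, h⟩ := Submodule.sub_projection_mem (isCompl_polarPart_regularPart hA) g
    refine ⟨σ p, σ t, ⟨by simpa using ht.1, fun a ha hdvd => ?_⟩, ?_⟩
    · obtain ⟨b, rfl⟩ := σ.surjective a
      exact ht.2 b ((hmem b).1 ha) ((map_dvd_iff σ).1 hdvd)
    · rw [polarProj, h, map_div₀, ← hσ, ← hσ]
  have h1 : polarProj hA' (T (g - polarProj hA g)) = 0 :=
    (Submodule.projection_apply_eq_zero_iff _).2 hreg
  have h2 : polarProj hA' (T (polarProj hA g)) = T (polarProj hA g) :=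
    Submodule.projection_apply_of_mem_left _ hpol
  rw [map_sub, map_sub, h2, sub_eq_zero] at h1
  exact h1.symm

end PolarParts

section Descent

variable {R M κ : Type*} [Ring R] [AddCommGroup M] [Module R M] [Fintype κ] [DecidableEq κ]

/-- Let `T i` be commuting automorphisms and let `π k` be projections, finitely many of which are
nonzero on each element, which are permuted by `T N` through `k ↦ k + 1` and commute with the
other `T i`. If `f` lies in the range of `π 0` and is killed by the other `π k`, then the
difference `T N g - g` can be removed from every representation of `f` as a sum of differences. -/
theorem exists_sum_sub_of_shifted_projections (T : κ → (M ≃ₗ[R] M)) (N : κ)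
    (hcomm : ∀ i, Commute (T i) (T N)) (π : ℤ → M →ₗ[R] M)
    (hπ : ∀ i, i ≠ N → ∀ k g, T i (π k g) = π k (T i g))
    (hπN : ∀ k g, T N (π k g) = π (k + 1) (T N g))
    (hfin : ∀ g, {k | π k g ≠ 0}.Finite) {f : M} (hf0 : π 0 f = f)
    (hf : ∀ k, k ≠ 0 → π k f = 0) (g : κ → M) (hg : f = ∑ i, (T i (g i) - g i)) :
    ∃ g' : κ → M, f = ∑ i ∈ Finset.univ.erase N, (T i (g' i) - g' i) := by
  have hsupp : ∀ g, (Function.support fun k : ℤ => (T N ^ (-k)) (π k g)).Finite := fun g =>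
    (hfin g).subset fun k hk h => hk (by simp [h])
  let Φ : M →+ M :=
    { toFun := fun g => ∑ᶠ k : ℤ, (T N ^ (-k)) (π k g)
      map_zero' := by simp
      map_add' := fun g h => by
        rw [← finsum_add_distrib (hsupp g) (hsupp h)]
        simp }
  have hΦ : ∀ g, Φ g = ∑ᶠ k : ℤ, (T N ^ (-k)) (π k g) := fun g => rfl
  have hΦf : Φ f = f := by
    rw [hΦ, finsum_eq_single _ 0 fun k hk => by simp [hf k hk]]
    simp [hf0]
  have hΦi : ∀ i, i ≠ N → ∀ g, Φ (T i g) = T i (Φ g) := by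
    intro i hi g
    rw [hΦ, hΦ, AddEquivClass.map_finsum]
    refine finsum_congr fun k => ?_
    rw [← hπ i hi, ← LinearEquiv.mul_apply, ← LinearEquiv.mul_apply,
      ((hcomm i).zpow_right (-k)).eq]
  have hΦN : ∀ g, Φ (T N g) = Φ g := by
    intro g
    rw [hΦ, hΦ, ← finsum_comp_equiv (Equiv.addRight (1 : ℤ))]
    refine finsum_congr fun k => ?_
    rw [Equiv.coe_addRight, ← hπN, ← LinearEquiv.mul_apply, ← zpow_add_one]
    congr 2
    ring
  refine ⟨fun i => Φ (g i), ?_⟩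
  conv_lhs => rw [← hΦf, hg, map_sum, ← Finset.sum_erase_add _ _ (Finset.mem_univ N)]
  rw [map_sub, hΦN, sub_self, add_zero]
  refine Finset.sum_congr rfl fun i hi => ?_
  rw [map_sub, hΦi i (Finset.ne_of_mem_erase hi)]

end Descent

section ThetaPow

variable {F L κ : Type*} [CommSemiring F] [Semiring L] [Algebra F L] [Fintype κ]
  {θ : κ → (L ≃ₐ[F] L)}

theorem thetaPowS_add (hθ : ∀ i l, Commute (θ i) (θ l)) (α β : κ → ℤ) :
    thetaPowS θ (α + β) = thetaPowS θ α * thetaPowS θ β := by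
  unfold thetaPowS
  induction (Finset.univ : Finset κ).toList with
  | nil => simp
  | cons i l ih =>
    have h : Commute (θ i ^ β i) (l.map fun i => θ i ^ α i).prod :=
      Commute.list_prod_right _ _ fun x hx => by
        obtain ⟨k, -, rfl⟩ := List.mem_map.1 hx
        exact (hθ i k).zpow_zpow _ _
    rw [List.map_cons, List.prod_cons, ih, Pi.add_apply, zpow_add, List.map_cons, List.prod_cons,
      List.map_cons, List.prod_cons]
    rw [mul_assoc, mul_assoc, ← mul_assoc (θ i ^ β i), h.eq]
    simp only [mul_assoc]

theorem thetaPowS_single [DecidableEq κ] (i : κ) (z : ℤ) :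
    thetaPowS θ (Pi.single i z) = θ i ^ z := by
  unfold thetaPowS
  rw [List.prod_map_eq_pow_single i]
  · rw [Pi.single_eq_same, List.count_eq_one_of_mem (Finset.nodup_toList _) (by simp), pow_one]
  · intro l hl _
    rw [Pi.single_eq_of_ne hl, zpow_zero]

theorem thetaPowS_zero : thetaPowS θ 0 = 1 := by
  simp [thetaPowS]

theorem thetaPowS_mem {S : Subgroup (L ≃ₐ[F] L)} (hθ : ∀ i, θ i ∈ S) (α : κ → ℤ) :
    thetaPowS θ α ∈ S := by
  refine list_prod_mem fun x hx => ?_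
  obtain ⟨k, -, rfl⟩ := List.mem_map.1 hx
  exact zpow_mem (hθ k) _

end ThetaPow

section Affine

open MvPolynomial

theorem MvRat.algEquiv_ext {F : Type*} [Field F] {n : ℕ} {S T : MvRat F n ≃ₐ[F] MvRat F n}
    (h : ∀ i, S (xv i) = T (xv i)) : S = T := by
  have hp : ∀ p : MvPolynomial (Fin n) F, S (algebraMap _ _ p) = T (algebraMap _ _ p) := by
    have : S.toAlgHom.comp (IsScalarTower.toAlgHom F (MvPolynomial (Fin n) F) (MvRat F n)) =
        T.toAlgHom.comp (IsScalarTower.toAlgHom F _ _) := MvPolynomial.algHom_ext h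
    exact fun p => DFunLike.congr_fun this p
  ext g
  obtain ⟨p, r, -, rfl⟩ := IsFractionRing.div_surjective (A := MvPolynomial (Fin n) F) g
  rw [map_div₀, map_div₀, hp, hp]

theorem degreeOf_aeval_le {F κ : Type*} [Field F] [Fintype κ] [DecidableEq κ] (i : κ)
    {f : κ → MvPolynomial κ F} (hf : ∀ l, (f l).degreeOf i ≤ if l = i then 1 else 0)
    (p : MvPolynomial κ F) : (aeval f p).degreeOf i ≤ p.degreeOf i := by
  rw [aeval_def, eval₂_eq']
  refine (degreeOf_sum_le _ _ _).trans (Finset.sup_le fun s hs => ?_)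
  refine (degreeOf_mul_le _ _ _).trans ?_
  rw [MvPolynomial.algebraMap_eq, degreeOf_C, zero_add]
  calc _ ≤ ∑ l, (f l ^ s l).degreeOf i := degreeOf_prod_le _ _ _
    _ ≤ ∑ l, s l * (if l = i then 1 else 0) := Finset.sum_le_sum fun l _ =>
      (degreeOf_pow_le _ _ _).trans (Nat.mul_le_mul_left _ (hf l))
    _ = s i := by simp
    _ ≤ _ := degreeOf_le_iff.1 le_rfl s hs

variable {F : Type*} [Field F] {m : ℕ}

theorem mem_x0degAut_of_affine {T : MvRat F (m + 1) ≃ₐ[F] MvRat F (m + 1)} (i : Fin (m + 1))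
    (hfix : ∀ l, i ≠ l → T (xv l) = xv l) {u w : F} (hu : u ≠ 0)
    (hT : T (xv i) = algebraMap F _ u * xv i + algebraMap F _ w) : T ∈ x0degAut F m := by
  let f : F → F → Fin (m + 1) → MvPolynomial (Fin (m + 1)) F :=
    fun u w => Function.update X i (C u * X i + C w)
  have hf : ∀ u w l, (f u w l).degreeOf 0 ≤ if l = 0 then 1 else 0 := by
    intro u w l
    have hX : ∀ l, (X l : MvPolynomial (Fin (m + 1)) F).degreeOf 0 = if l = 0 then 1 else 0 :=
      fun l => by rw [degreeOf_X]; simp only [eq_comm]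
    by_cases h : l = i
    · subst h
      simp only [f, Function.update_self]
      refine (degreeOf_add_le _ _ _).trans (max_le ?_ (by simp))
      exact (degreeOf_C_mul_le _ _ _).trans (hX l).le
    · simp only [f, Function.update_of_ne h]
      exact (hX l).le
  have hcomp : ∀ u w u' w', u * u' = 1 → u' * w + w' = 0 →
      (aeval (f u w)).comp (aeval (f u' w')) = AlgHom.id F _ := by
    intro u w u' w' huu hw
    refine MvPolynomial.algHom_ext fun l => ?_
    by_cases h : l = i
    · subst h
      have h1 : (C u * C u' : MvPolynomial (Fin (m + 1)) F) = 1 := by rw [← C_mul, huu, C_1]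
      have h2 : (C u' * C w + C w' : MvPolynomial (Fin (m + 1)) F) = 0 := by
        rw [← C_mul, ← C_add, hw, C_0]
      simp [f, MvPolynomial.algebraMap_eq]
      linear_combination X l * h1 + h2
    · simp [f, Function.update_of_ne h]
  let σ : MvPolynomial (Fin (m + 1)) F ≃ₐ[F] MvPolynomial (Fin (m + 1)) F :=
    AlgEquiv.ofAlgHom (aeval (f u w)) (aeval (f u⁻¹ (-(u⁻¹ * w))))
      (hcomp _ _ _ _ (mul_inv_cancel₀ hu) (by ring))
      (hcomp _ _ _ _ (inv_mul_cancel₀ hu) (by field_simp; ring))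
  refine ⟨σ, fun p => ?_, fun p => ?_⟩
  · have : (IsScalarTower.toAlgHom F _ (MvRat F (m + 1))).comp σ.toAlgHom =
        T.toAlgHom.comp (IsScalarTower.toAlgHom F (MvPolynomial (Fin (m + 1)) F) _) := by
      refine MvPolynomial.algHom_ext fun l => ?_
      change algebraMap _ (MvRat F (m + 1)) (aeval (f u w) (X l)) = T (xv l)
      rw [aeval_X]
      by_cases h : l = i
      · subst h
        rw [hT]
        simp only [f, Function.update_self, map_add, map_mul]
        rfl
      · rw [hfix l (Ne.symm h)]
        simp only [f, Function.update_of_ne h, xv]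
    exact DFunLike.congr_fun this p
  · by_cases hp : p = 0
    · simp [hp]
    have hp' : σ p ≠ 0 := by simpa using hp
    rw [x0deg_eq_degreeOf hp, x0deg_eq_degreeOf hp']
    congr 1
    refine le_antisymm (degreeOf_aeval_le 0 (hf _ _) p) ?_
    conv_lhs => rw [← σ.symm_apply_apply p]
    exact degreeOf_aeval_le 0 (hf _ _) (σ p)

theorem commute_of_affine {n : ℕ} {θ : Fin n → (MvRat F n ≃ₐ[F] MvRat F n)}
    (hfix : ∀ i l, i ≠ l → θ i (xv l) = xv l) {u w : Fin n → F}
    (hθ : ∀ i, θ i (xv i) = algebraMap F _ (u i) * xv i + algebraMap F _ (w i)) (i l : Fin n) :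
    Commute (θ i) (θ l) := by
  rcases eq_or_ne i l with rfl | hil
  · exact Commute.refl _
  refine MvRat.algEquiv_ext fun k => ?_
  simp only [AlgEquiv.mul_apply]
  by_cases hi : i = k
  · subst hi
    simp [hfix l i hil.symm, hθ]
  · by_cases hl : l = k
    · subst hl
      simp [hfix i l hil, hθ]
    · rw [hfix i k hi, hfix l k hl, hfix i k hi]

end Affine

section Orbit

open MvPolynomial

variable {F : Type*} [Field F] {m : ℕ}

local notation "ι" => algebraMap (MvPolynomial (Fin (m + 1)) F) (MvRat F (m + 1))

theorem exists_div_of_mem_hatField {g : MvRat F (m + 1)} (hg : g ∈ hatField F (m + 1)) :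
    ∃ p e : MvPolynomial (Fin (m + 1)) F, x0deg p ≤ 0 ∧ x0deg e = 0 ∧ g = ι p / ι e := by
  induction hg using Subfield.closure_induction with
  | mem g hg =>
    rcases hg with ⟨c, rfl⟩ | ⟨i, hi, rfl⟩
    · refine ⟨C c, 1, ?_, x0deg_one, ?_⟩
      · by_cases hc : c = 0
        · simp [hc, x0deg]
        · exact (x0deg_of_degreeOf_eq_zero (by simpa using hc) (degreeOf_C c 0)).le
      · rw [map_one, div_one, IsScalarTower.algebraMap_apply F (MvPolynomial (Fin (m + 1)) F),
          MvPolynomial.algebraMap_eq]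
    · exact ⟨X i, 1, (x0deg_of_degreeOf_eq_zero (X_ne_zero i)
        (degreeOf_X_of_ne (Ne.symm hi))).le, x0deg_one, by simp [xv]⟩
  | one => exact ⟨1, 1, x0deg_one.le, x0deg_one, by simp⟩
  | add x y _ _ hx hy =>
    obtain ⟨p, e, hp, he, rfl⟩ := hx
    obtain ⟨p', e', hp', he', rfl⟩ := hy
    refine ⟨p * e' + e * p', e * e', (x0deg_add_le _ _).trans (max_le ?_ ?_),
      by simp [x0deg_mul, he, he'], ?_⟩
    · simpa [x0deg_mul, he'] using hp
    · simpa [x0deg_mul, he] using hp'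
    · rw [div_add_div _ _ (algebraMap_mvRat_ne_zero (ne_zero_of_x0deg_eq_zero he))
        (algebraMap_mvRat_ne_zero (ne_zero_of_x0deg_eq_zero he'))]
      simp
  | neg x _ hx =>
    obtain ⟨p, e, hp, he, rfl⟩ := hx
    exact ⟨-p, e, by simpa [x0deg] using hp, he, by rw [map_neg, neg_div]⟩
  | inv x _ hx =>
    obtain ⟨p, e, hp, he, rfl⟩ := hx
    by_cases hp0 : p = 0
    · exact ⟨0, 1, by simp [x0deg], x0deg_one, by simp [hp0]⟩
    · refine ⟨e, p, he.le, ?_, by rw [inv_div]⟩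
      rw [x0deg_eq_degreeOf hp0] at hp ⊢
      norm_cast at hp ⊢
      omega
  | mul x y _ _ hx hy =>
    obtain ⟨p, e, hp, he, rfl⟩ := hx
    obtain ⟨p', e', hp', he', rfl⟩ := hy
    exact ⟨p * p', e * e', by rw [x0deg_mul]; exact add_nonpos hp hp',
      by simp [x0deg_mul, he, he'], by rw [map_mul, map_mul, div_mul_div_comm]⟩

theorem exists_div_of_isPolyDeg {D : ℕ} {a : MvRat F (m + 1)}
    (ha : IsPolyDeg (hatField F (m + 1)) (xv 0) D a) :
    ∃ p e : MvPolynomial (Fin (m + 1)) F, x0deg p < D ∧ x0deg e = 0 ∧ a = ι p / ι e := by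
  obtain ⟨cf, rfl⟩ := ha
  refine Finset.sum_induction _ (fun a : MvRat F (m + 1) => ∃ p e : MvPolynomial (Fin (m + 1)) F,
    x0deg p < D ∧ x0deg e = 0 ∧ a = ι p / ι e) ?_ ?_ ?_
  · rintro _ _ ⟨p, e, hp, he, rfl⟩ ⟨p', e', hp', he', rfl⟩
    refine ⟨p * e' + e * p', e * e', (x0deg_add_le _ _).trans_lt (max_lt ?_ ?_),
      by simp [x0deg_mul, he, he'], ?_⟩
    · simpa [x0deg_mul, he'] using hp
    · simpa [x0deg_mul, he] using hp'
    · rw [div_add_div _ _ (algebraMap_mvRat_ne_zero (ne_zero_of_x0deg_eq_zero he))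
        (algebraMap_mvRat_ne_zero (ne_zero_of_x0deg_eq_zero he'))]
      simp
  · exact ⟨0, 1, by simp [x0deg], x0deg_one, by simp⟩
  · rintro k -
    obtain ⟨p, e, hp, he, h⟩ := exists_div_of_mem_hatField (cf k).2
    refine ⟨p * X 0 ^ (k : ℕ), e, ?_, he, ?_⟩
    · have hX : x0deg (X 0 ^ (k : ℕ) : MvPolynomial (Fin (m + 1)) F) = (k : ℕ) := by
        simp [x0deg, finSuccEquiv_X_zero]
      rw [x0deg_mul, hX]
      calc x0deg p + ((k : ℕ) : WithBot ℕ) ≤ 0 + ((k : ℕ) : WithBot ℕ) := by gcongr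
        _ < D := by rw [zero_add]; exact_mod_cast k.2
    · rw [h, map_mul, map_pow, xv, div_mul_eq_mul_div]

/-- The polynomials `θ^α(d)` with `θ_{xₙ}`-exponent `αₙ = k`. -/
def orbitSlice (θ : Fin (m + 1) → (MvRat F (m + 1) ≃ₐ[F] MvRat F (m + 1)))
    (d : MvPolynomial (Fin (m + 1)) F) (k : ℤ) : Set (MvPolynomial (Fin (m + 1)) F) :=
  {a | ∃ α : Fin (m + 1) → ℤ, α (Fin.last m) = k ∧ ι a = thetaPowS θ α (ι d)}

variable {θ : Fin (m + 1) → (MvRat F (m + 1) ≃ₐ[F] MvRat F (m + 1))}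
  {d : MvPolynomial (Fin (m + 1)) F}

theorem isPolarSet_orbitSlice (hθ : ∀ i, θ i ∈ x0degAut F m) (hd : Irreducible d)
    (hdeg : 0 < x0deg d) (k : ℤ) : IsPolarSet (orbitSlice θ d k) := by
  rintro a ⟨α, -, ha⟩
  obtain ⟨σ, hσ, hσdeg⟩ := thetaPowS_mem hθ α
  obtain rfl : a = σ d := IsFractionRing.injective _ (MvRat F (m + 1)) (ha.trans (hσ d).symm)
  exact ⟨(MulEquiv.irreducible_iff σ).2 hd, by rwa [hσdeg]⟩

theorem mem_orbitSlice_zero : d ∈ orbitSlice θ d 0 :=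
  ⟨0, rfl, by rw [thetaPowS_zero, AlgEquiv.one_apply]⟩

theorem mem_orbitSlice_iff_of_eq (hcomm : ∀ i l, Commute (θ i) (θ l)) (i : Fin (m + 1)) (k : ℤ)
    {a b : MvPolynomial (Fin (m + 1)) F} (hab : ι b = θ i (ι a)) :
    b ∈ orbitSlice θ d (k + (Pi.single i 1 : Fin (m + 1) → ℤ) (Fin.last m)) ↔
      a ∈ orbitSlice θ d k := by
  constructor
  · rintro ⟨α, hα, h⟩
    refine ⟨Pi.single i (-1) + α, ?_, ?_⟩
    · rw [Pi.add_apply, hα, Pi.single_neg, Pi.neg_apply]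
      ring
    · rw [thetaPowS_add hcomm, thetaPowS_single, AlgEquiv.mul_apply, ← h, hab,
        ← AlgEquiv.mul_apply, zpow_neg_one, inv_mul_cancel, AlgEquiv.one_apply]
  · rintro ⟨α, hα, h⟩
    refine ⟨Pi.single i 1 + α, by rw [Pi.add_apply, hα, add_comm], ?_⟩
    rw [thetaPowS_add hcomm, thetaPowS_single, AlgEquiv.mul_apply, ← h, hab, zpow_one]

theorem orbitSlice_index_eq_of_associated (hcomm : ∀ i l, Commute (θ i) (θ l))
    (hGH : ∀ α : Fin (m + 1) → ℤ,
      (∃ c : F, c ≠ 0 ∧ thetaPowS θ α (ι d) = algebraMap F _ c * ι d) → α (Fin.last m) = 0)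
    {k l : ℤ} {a b : MvPolynomial (Fin (m + 1)) F} (ha : a ∈ orbitSlice θ d k)
    (hb : b ∈ orbitSlice θ d l) (hab : Associated a b) : k = l := by
  obtain ⟨α, rfl, hα⟩ := ha
  obtain ⟨β, rfl, hβ⟩ := hb
  obtain ⟨u, rfl⟩ := hab
  obtain ⟨c, hc, hu⟩ := isUnit_iff_eq_C_of_isReduced.1 u.isUnit
  have h := hGH (-α + β) ⟨c, hc.ne_zero, ?_⟩
  · rw [Pi.add_apply, Pi.neg_apply] at h
    linarith
  · rw [thetaPowS_add hcomm, AlgEquiv.mul_apply, ← hβ, hu, map_mul, hα,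
      ← MvPolynomial.algebraMap_eq, ← IsScalarTower.algebraMap_apply, map_mul, AlgEquiv.commutes, ← AlgEquiv.mul_apply,
      ← thetaPowS_add hcomm, neg_add_cancel, thetaPowS_zero, AlgEquiv.one_apply, mul_comm]

theorem finite_setOf_exists_dvd {B : ℤ → Set (MvPolynomial (Fin (m + 1)) F)}
    (hB : ∀ k, IsPolarSet (B k))
    (hdisj : ∀ k l, ∀ a ∈ B k, ∀ b ∈ B l, Associated a b → k = l)
    {r : MvPolynomial (Fin (m + 1)) F} (hr : r ≠ 0) : {k | ∃ a ∈ B k, a ∣ r}.Finite := by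
  induction r using UniqueFactorizationMonoid.induction_on_prime with
  | h₁ => exact absurd rfl hr
  | h₂ u hu =>
    refine Set.finite_empty.subset ?_
    rintro k ⟨a, ha, hau⟩
    exact (hB k a ha).1.not_isUnit (isUnit_of_dvd_unit hau hu)
  | h₃ r p hr' hp ih =>
    have hsub : {k | ∃ a ∈ B k, a ∣ p}.Subsingleton := by
      rintro k ⟨a, ha, hap⟩ l ⟨b, hb, hbp⟩
      exact hdisj k l a ha b hb (((hB k a ha).1.associated_of_dvd hp.irreducible hap).trans
        ((hB l b hb).1.associated_of_dvd hp.irreducible hbp).symm)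
    refine (hsub.finite.union (ih hr')).subset ?_
    rintro k ⟨a, ha, h⟩
    exact ((hB k a ha).1.prime.dvd_or_dvd h).imp (fun h => ⟨a, ha, h⟩) fun h => ⟨a, ha, h⟩

theorem finite_setOf_polarProj_ne_zero {B : ℤ → Set (MvPolynomial (Fin (m + 1)) F)}
    (hB : ∀ k, IsPolarSet (B k))
    (hdisj : ∀ k l, ∀ a ∈ B k, ∀ b ∈ B l, Associated a b → k = l)
    (g : MvRat F (m + 1)) : {k | polarProj (hB k) g ≠ 0}.Finite := by
  obtain ⟨p, r, hr, rfl⟩ := IsFractionRing.div_surjective (A := MvPolynomial (Fin (m + 1)) F) g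
  have hr0 := nonZeroDivisors.ne_zero hr
  refine (finite_setOf_exists_dvd hB hdisj hr0).subset fun k hk => ?_
  by_contra h
  simp only [Set.mem_ofPred_eq, not_exists, not_and] at h
  exact hk ((Submodule.projection_apply_eq_zero_iff _).2 ⟨p, r, ⟨hr0, h⟩, rfl⟩)

/-- The automorphism `θ` followed by multiplication with a nonzero constant, as a linear map. -/
noncomputable def scaledAut {L : Type*} [Field L] [Algebra F L] (T : L ≃ₐ[F] L) {c : F}
    (hc : c ≠ 0) : L ≃ₗ[F] L :=
  T.toLinearEquiv.trans (LinearEquiv.smulOfNeZero F L c hc)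

theorem scaledAut_apply {L : Type*} [Field L] [Algebra F L] (T : L ≃ₐ[F] L) {c : F}
    (hc : c ≠ 0) (g : L) : scaledAut T hc g = algebraMap F L c * T g :=
  Algebra.smul_def c (T g)

theorem commute_scaledAut {L : Type*} [Field L] [Algebra F L] {S T : L ≃ₐ[F] L}
    (h : Commute S T) {b c : F} (hb : b ≠ 0) (hc : c ≠ 0) :
    Commute (scaledAut S hb) (scaledAut T hc) := by
  ext g
  have hST : S (T g) = T (S g) := DFunLike.congr_fun h.eq g
  simp only [LinearEquiv.mul_apply, scaledAut_apply, map_mul, AlgEquiv.commutes, hST]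
  ring

theorem exists_sum_erase_last_of_exists_sum (hθ : ∀ i, θ i ∈ x0degAut F m)
    (hcomm : ∀ i l, Commute (θ i) (θ l)) (hd : Irreducible d) (hdeg : 0 < d.degreeOf 0)
    {j : ℕ} (hj : 1 ≤ j) {a : MvRat F (m + 1)}
    (ha : IsPolyDeg (hatField F (m + 1)) (xv 0) (d.degreeOf 0) a)
    (hGH : ∀ α : Fin (m + 1) → ℤ,
      (∃ c : F, c ≠ 0 ∧ thetaPowS θ α (ι d) = algebraMap F _ c * ι d) → α (Fin.last m) = 0)
    {c : Fin (m + 1) → F} (hc : ∀ i, c i ≠ 0) (g : Fin (m + 1) → MvRat F (m + 1))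
    (hg : a / ι d ^ j = ∑ i, (algebraMap F _ (c i) * θ i (g i) - g i)) :
    ∃ g : Fin (m + 1) → MvRat F (m + 1),
      a / ι d ^ j = ∑ i ∈ Finset.univ.erase (Fin.last m),
        (algebraMap F _ (c i) * θ i (g i) - g i) := by
  obtain ⟨p, e, hp, he, rfl⟩ := exists_div_of_isPolyDeg ha
  have hd0 := hd.ne_zero
  have hdeg' : 0 < x0deg d := by
    rw [x0deg_eq_degreeOf hd0]
    exact_mod_cast hdeg
  rw [← x0deg_eq_degreeOf hd0] at hp
  have hB := isPolarSet_orbitSlice hθ hd hdeg'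
  have hdisj : ∀ k l, ∀ a ∈ orbitSlice θ d k, ∀ b ∈ orbitSlice θ d l, Associated a b → k = l :=
    fun k l a ha b hb => orbitSlice_index_eq_of_associated hcomm hGH ha hb
  have hfrac : ι p / ι e / ι d ^ j = ι p / ι (d ^ j * e) := by
    rw [div_div, map_mul, map_pow, mul_comm]
  have hmap : ∀ i k g, scaledAut (θ i) (hc i) (polarProj (hB k) g) =
      polarProj (hB (k + (Pi.single i 1 : Fin (m + 1) → ℤ) (Fin.last m)))
        (scaledAut (θ i) (hc i) g) := by
    intro i k g
    rw [scaledAut_apply, scaledAut_apply, ← Algebra.smul_def, ← Algebra.smul_def, map_smul,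
      map_polarProj (hB k) (hB _) (hθ i) fun a b => mem_orbitSlice_iff_of_eq hcomm i k]
  obtain ⟨g', hg'⟩ := exists_sum_sub_of_shifted_projections (fun i => scaledAut (θ i) (hc i))
    (Fin.last m) (fun i => commute_scaledAut (hcomm i _) _ _) (fun k => polarProj (hB k))
    (fun i hi k g => by
      have h := hmap i k g
      simp only [Pi.single_eq_of_ne (Ne.symm hi), add_zero] at h
      exact h)
    (fun k g => by
      have h := hmap (Fin.last m) k g
      simp only [Pi.single_eq_same] at h
      exact h)
    (finite_setOf_polarProj_ne_zero hB hdisj)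
    (f := ι p / ι e / ι d ^ j)
    (by
      rw [hfrac]
      exact Submodule.projection_apply_of_mem_left _
        (mem_polarPart_of_x0deg_lt (hB 0) mem_orbitSlice_zero hj he hp))
    (fun k hk => by
      rw [hfrac]
      refine (Submodule.projection_apply_eq_zero_iff _).2 ⟨p, _, AvoidsSet.mul (hB k)
        ⟨pow_ne_zero j hd0, fun b hb hbd => hk ?_⟩ (.of_x0deg_eq_zero (hB k) he), rfl⟩
      exact hdisj k 0 b hb d mem_orbitSlice_zero
        ((hB k b hb).1.associated_of_dvd hd ((hB k b hb).1.prime.dvd_of_dvd_pow hbd)))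
    g (by simpa only [scaledAut_apply] using hg)
  exact ⟨g', by simpa only [scaledAut_apply] using hg'⟩

end Orbit

set_option maxHeartbeats 1000000 in
/-- **Lemma: rank-0 reduction.** Let `n > 1`, `f = a/d^j` a simple fraction
(`d ∈ F[x]` irreducible, normal w.r.t. `θ_{x₁}`, `deg_{x₁} a < deg_{x₁} d`, `j ≥ 1`).
Suppose `rank G_d/H_d = 0`, i.e. `G_d = H_d` (every element of the isotropy group of `d`
has trivial `θ_{xₙ}`-exponent). Then for nonzero `c₁,…,cₙ ∈ F`, `f` is
`(c₁θ_{x₁},…,cₙθ_{xₙ})`-summable in `F(x)` iff `f` is `(c₁θ_{x₁},…,c_{n−1}θ_{x_{n−1}})`-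
summable in `F(x)`. -/
theorem stmt_9 {F : Type*} [Field F] [CharZero F] {n : ℕ} [NeZero n] (hn : 1 < n)
    (q : F) (hq0 : q ≠ 0) (hq : ∀ l : ℤ, l ≠ 0 → q ^ l ≠ 1)
    (θ : Fin n → (MvRat F n ≃ₐ[F] MvRat F n))
    (hθfix : ∀ i l : Fin n, i ≠ l → θ i (xv l) = xv l)
    (hθ : ∀ i : Fin n,
      θ i (xv i) = xv i + 1 ∨ θ i (xv i) = algebraMap F (MvRat F n) q * xv i)
    (d : MvPolynomial (Fin n) F) (hd : Irreducible d) (hdeg : 0 < d.degreeOf 0)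
    (hnorm : NormalWrt (hatField F n) (xv 0) (θ 0)
      (algebraMap (MvPolynomial (Fin n) F) (MvRat F n) d))
    (j : ℕ) (hj : 1 ≤ j)
    (a : MvRat F n) (ha : IsPolyDeg (hatField F n) (xv 0) (d.degreeOf 0) a)
    (hGH : ∀ α : Fin n → ℤ,
      (∃ c : F, c ≠ 0 ∧
        thetaPowS θ α (algebraMap (MvPolynomial (Fin n) F) (MvRat F n) d) =
          algebraMap F (MvRat F n) c * algebraMap (MvPolynomial (Fin n) F) (MvRat F n) d) →
      α ⟨n - 1, by omega⟩ = 0)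
    (c : Fin n → F) (hc : ∀ i, c i ≠ 0) :
    (∃ g : Fin n → MvRat F n,
        a / algebraMap (MvPolynomial (Fin n) F) (MvRat F n) d ^ j =
          ∑ i : Fin n, (algebraMap F (MvRat F n) (c i) * θ i (g i) - g i)) ↔
    (∃ g : Fin n → MvRat F n,
        a / algebraMap (MvPolynomial (Fin n) F) (MvRat F n) d ^ j =
          ∑ i ∈ Finset.univ.erase (⟨n - 1, by omega⟩ : Fin n),
            (algebraMap F (MvRat F n) (c i) * θ i (g i) - g i)) := by
  obtain _ | m := n
  · omega
  constructor
  · rintro ⟨g, hg⟩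
    have haff : ∀ i, ∃ u w : F, u ≠ 0 ∧
        θ i (xv i) = algebraMap F _ u * xv i + algebraMap F _ w := fun i =>
      (hθ i).elim (fun h => ⟨1, 1, one_ne_zero, by simp [h]⟩)
        fun h => ⟨q, 0, hq0, by simp [h]⟩
    choose u w hu hθ' using haff
    exact exists_sum_erase_last_of_exists_sum
      (fun i => mem_x0degAut_of_affine i (hθfix i) (hu i) (hθ' i))
      (commute_of_affine hθfix hθ') hd hdeg hj ha hGH hc g hg
  · rintro ⟨g, hg⟩
    refine ⟨Function.update g ⟨m + 1 - 1, by omega⟩ 0, ?_⟩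
    rw [← Finset.sum_erase_add _ _ (Finset.mem_univ (⟨m + 1 - 1, by omega⟩ : Fin (m + 1))),
      Function.update_self, map_zero, mul_zero, sub_zero, add_zero, hg]
    refine Finset.sum_congr rfl fun i hi => ?_
    rw [Function.update_of_ne (Finset.ne_of_mem_erase hi)]
end
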